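/- arXiv:2006.08499 — 5 statements merged into one kernel-verified Lean document; each statement's English description precedes it below -/
import Mathlib

section
/- Let S be a semigroup and let H be an H-class of S. If S is weakly subsemigroup separable and the Schützenberger group Γ(H) is abelian, then Γ(H) is weakly subgroup separable. -/
open scoped Pointwise

/-- A semigroup is residually finite if distinct points can be distinguished in a
finite semigroup quotient (image). -/
def IsResiduallyFiniteSemigroup (S : Type*) [Semigroup S] : Prop :=
  ∀ s t : S, s ≠ t →
    ∃ (U : Type) (_ : Semigroup U) (_ : Finite U) (f : S →ₙ* U), f s ≠ f t

/-- A semigroup is weakly subsemigroup separable if every element outside a finitely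
generated subsemigroup can be separated from it in a finite semigroup image. -/
def IsWeaklySubsemigroupSeparable (S : Type*) [Semigroup S] : Prop :=
  ∀ T : Subsemigroup S, (∃ Y : Finset S, T = Subsemigroup.closure (Y : Set S)) →
    ∀ s : S, s ∉ T →
      ∃ (U : Type) (_ : Semigroup U) (_ : Finite U) (f : S →ₙ* U),
        f s ∉ f '' (T : Set S)

/-- A semigroup is strongly subsemigroup separable if every element outside a
subsemigroup can be separated from it in a finite semigroup image. -/
def IsStronglySubsemigroupSeparable (S : Type*) [Semigroup S] : Prop :=
  ∀ T : Subsemigroup S, ∀ s : S, s ∉ T →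
    ∃ (U : Type) (_ : Semigroup U) (_ : Finite U) (f : S →ₙ* U),
      f s ∉ f '' (T : Set S)

/-- A semigroup is completely separable if every element can be separated from its
complement in a finite semigroup image. -/
def IsCompletelySeparable (S : Type*) [Semigroup S] : Prop :=
  ∀ s : S,
    ∃ (U : Type) (_ : Semigroup U) (_ : Finite U) (f : S →ₙ* U),
      f s ∉ f '' {t : S | t ≠ s}

/-- A semigroup is locally finite if every finitely generated subsemigroup is finite. -/
def IsLocallyFiniteSemigroup (S : Type*) [Semigroup S] : Prop :=
  ∀ Y : Finset S, ((Subsemigroup.closure (Y : Set S) : Subsemigroup S) : Set S).Finite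

/-- A group is weakly subgroup separable (LERF) if every element outside a finitely
generated subgroup can be separated from it in a finite group image. -/
def IsWeaklySubgroupSeparable (G : Type*) [Group G] : Prop :=
  ∀ H : Subgroup G, H.FG → ∀ g : G, g ∉ H →
    ∃ (K : Type) (_ : Group K) (_ : Finite K) (f : G →* K),
      f g ∉ f '' (H : Set G)

/-- A group is strongly subgroup separable (ERF) if every element outside a subgroup
can be separated from it in a finite group image. -/
def IsStronglySubgroupSeparable (G : Type*) [Group G] : Prop :=
  ∀ H : Subgroup G, ∀ g : G, g ∉ H →
    ∃ (K : Type) (_ : Group K) (_ : Finite K) (f : G →* K),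
      f g ∉ f '' (H : Set G)

/-- Green's relation H: x H y iff xS¹ = yS¹ and S¹x = S¹y. -/
def GreenH {S : Type*} [Semigroup S] (x y : S) : Prop :=
  insert x {z : S | ∃ s : S, z = x * s} = insert y {z : S | ∃ s : S, z = y * s} ∧
  insert x {z : S | ∃ s : S, z = s * x} = insert y {z : S | ∃ s : S, z = s * y}

/-- The H-class of an element. -/
def HClass {S : Type*} [Semigroup S] (x : S) : Set S := {y : S | GreenH x y}

/-- The n-fold pointwise product A·A⋯A (for n ≥ 1; we set the value at 0 to be A). -/
def SetNPow {S : Type*} [Semigroup S] (A : Set S) : ℕ → Set S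
  | 0 => A
  | 1 => A
  | n + 2 => SetNPow A (n + 1) * A

/-- The right stabiliser Stab(H) = {s ∈ S¹ | Hs = H}, a submonoid of S¹ = WithOne S. -/
def SchStab {S : Type*} [Semigroup S] (H : Set S) : Submonoid (WithOne S) where
  carrier := {s : WithOne S |
    (fun h => h * s) '' ((fun x : S => (x : WithOne S)) '' H)
      = (fun x : S => (x : WithOne S)) '' H}
  one_mem' := by
    simp only [Set.mem_setOf_eq, mul_one, Set.image_id']
  mul_mem' := by
    intro a b ha hb
    simp only [Set.mem_setOf_eq] at ha hb ⊢
    have hcomp : (fun h : WithOne S => h * (a * b))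
        = (fun h : WithOne S => h * b) ∘ fun h : WithOne S => h * a := by
      funext h; simp [mul_assoc]
    rw [hcomp, Set.image_comp, ha, hb]

/-- `(Γ, φ)` realises the Schützenberger group of the H-class `H`: `φ` is a surjective
monoid homomorphism from `Stab(H)` onto the group `Γ` whose kernel relation is exactly
the Schützenberger congruence `σ_H`. -/
def IsSchutzenbergerGroup {S : Type*} [Semigroup S] (H : Set S) (Γ : Type*) [Group Γ]
    (φ : SchStab H →* Γ) : Prop :=
  Function.Surjective φ ∧
    ∀ a b : SchStab H,
      φ a = φ b ↔ ∀ h ∈ H,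
        (h : WithOne S) * (a : WithOne S) = (h : WithOne S) * (b : WithOne S)

/-- A subset of a group is closed in the profinite topology, i.e. every element outside it has
a coset of a finite-index subgroup disjoint from it. -/
def ProfinitelyClosed {Γ : Type*} [Group Γ] (C : Set Γ) : Prop :=
  ∀ g ∉ C, ∃ N : Subgroup Γ, N.FiniteIndex ∧ ∀ n ∈ N, g * n ∉ C

section Profinite

variable {Γ : Type*}

theorem ProfinitelyClosed.inv_mem [Group Γ] {C : Set Γ} (hC : ProfinitelyClosed C) {c : Γ}
    (hc : ∀ k : ℕ, c ^ k ∈ C) : c⁻¹ ∈ C := by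
  by_contra h
  obtain ⟨N, hN, hd⟩ := hC _ h
  obtain ⟨k, hk, -, hkN⟩ := Subgroup.exists_pow_mem_of_index_ne_zero hN.index_ne_zero c
  obtain ⟨j, rfl⟩ := Nat.exists_eq_succ_of_ne_zero hk.ne'
  apply hd _ hkN
  rw [Nat.succ_eq_add_one, pow_succ', inv_mul_cancel_left]
  exact hc j

theorem ProfinitelyClosed.of_smul [Group Γ] {C D : Set Γ} (hC : ProfinitelyClosed C) (a : Γ)
    (h : ∀ g, g ∈ D ↔ a * g ∈ C) : ProfinitelyClosed D := by
  intro g hg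
  obtain ⟨N, hN, hd⟩ := hC (a * g) (fun h' => hg ((h g).2 h'))
  refine ⟨N, hN, fun n hn h' => hd n hn ?_⟩
  rw [mul_assoc]
  exact (h _).1 h'

/-- A profinitely closed submonoid is a subgroup. -/
theorem ProfinitelyClosed.exists_subgroup [Group Γ] {M : Submonoid Γ}
    (hM : ProfinitelyClosed (M : Set Γ)) : ∃ K : Subgroup Γ, K.toSubmonoid = M :=
  ⟨{ M with inv_mem' := fun {c} hc => hM.inv_mem fun k => pow_mem (show c ∈ M from hc) k }, rfl⟩

/-- A finitely generated subgroup of a commutative group is profinitely closed if it contains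
a profinitely closed subgroup modulo which its generators have finite order. -/
theorem ProfinitelyClosed.of_torsion_quotient [CommGroup Γ] {M : Subgroup Γ}
    (hM : ProfinitelyClosed (M : Set Γ)) {X : Set Γ} (hX : X.Finite)
    (hMK : M ≤ Subgroup.closure X) (ht : ∀ c ∈ X, ∃ k : ℕ, 0 < k ∧ c ^ k ∈ M) :
    ProfinitelyClosed (Subgroup.closure X : Set Γ) := by
  set K := Subgroup.closure X with hK
  let K' : Subgroup (Γ ⧸ M) := K.map (QuotientGroup.mk' M)
  have hK' : K' = Subgroup.closure (QuotientGroup.mk' M '' X) := MonoidHom.map_closure _ _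
  have hfg : Group.FG K' := by
    rw [Group.fg_iff_subgroup_fg, Subgroup.fg_iff]
    exact ⟨_, hK'.symm, hX.image _⟩
  have htor : K' ≤ CommGroup.torsion (Γ ⧸ M) := by
    rw [hK', Subgroup.closure_le]
    rintro _ ⟨c, hc, rfl⟩
    obtain ⟨k, hk, hkM⟩ := ht c hc
    change IsOfFinOrder _
    rw [isOfFinOrder_iff_pow_eq_one]
    refine ⟨k, hk, ?_⟩
    rw [← map_pow]
    exact (QuotientGroup.eq_one_iff _).2 hkM
  have htor' : IsMulTorsion K' := fun q => Submonoid.isOfFinOrder_coe.1 (htor q.2)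
  have hfin : Finite K' := CommGroup.finite_of_fg_isMulTorsion K' htor'
  intro g hg
  have hrep : ∀ q : K', ∃ k ∈ K, (QuotientGroup.mk' M) k = q := fun q => q.2
  choose r hrK hr using hrep
  have hsep : ∀ q : K', (r q)⁻¹ * g ∉ (M : Set Γ) := fun q h =>
    hg (by simpa using mul_mem (hrK q) (hMK h))
  choose N hN hNd using fun q => hM _ (hsep q)
  refine ⟨⨅ q, N q, Subgroup.finiteIndex_iInf hN, fun n hn hk => ?_⟩
  have hq : QuotientGroup.mk' M (g * n) ∈ K' := ⟨_, hk, rfl⟩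
  apply hNd ⟨_, hq⟩ n (Subgroup.mem_iInf.1 hn _)
  rw [mul_assoc]
  exact QuotientGroup.eq.1 (hr ⟨_, hq⟩)

theorem isWeaklySubgroupSeparable_of_profinitelyClosed [CommGroup Γ]
    (h : ∀ X : Finset Γ, ProfinitelyClosed (Subgroup.closure (X : Set Γ) : Set Γ)) :
    IsWeaklySubgroupSeparable Γ := by
  rintro _ ⟨X, rfl⟩ g hg
  obtain ⟨N, hN, hd⟩ := h X g hg
  have : Finite (Γ ⧸ N) := Subgroup.finiteIndex_iff_finite_quotient.1 hN
  obtain ⟨G, _, _, ⟨φ⟩⟩ := Finite.exists_type_univ_nonempty_mulEquiv (Γ ⧸ N)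
  refine ⟨G, inferInstance, Finite.of_fintype G, φ.toMonoidHom.comp (QuotientGroup.mk' N), ?_⟩
  rintro ⟨k, hk, hkg⟩
  have hN' : g⁻¹ * k ∈ N := QuotientGroup.eq.1 (φ.injective hkg).symm
  exact hd _ hN' (by simpa using hk)

end Profinite

section Actions

variable {S Γ : Type*} [Semigroup S] [CommGroup Γ]

/-- `s` acts by right multiplication on the range of `e` as translation by `c`. -/
def RightActsAs (e : Γ → S) (s : S) (c : Γ) : Prop := ∀ d, e d * s = e (d * c)

/-- `s` acts by left multiplication on the range of `e` as translation by `c`. -/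
def LeftActsAs (e : Γ → S) (s : S) (c : Γ) : Prop := ∀ d, s * e d = e (c * d)

theorem RightActsAs.mul {e : Γ → S} {s t : S} {c d : Γ} (hs : RightActsAs e s c)
    (ht : RightActsAs e t d) : RightActsAs e (s * t) (c * d) := fun a => by
  rw [← mul_assoc, hs, ht, mul_assoc]

theorem LeftActsAs.mul {e : Γ → S} {s t : S} {c d : Γ} (hs : LeftActsAs e s c)
    (ht : LeftActsAs e t d) : LeftActsAs e (s * t) (c * d) := fun a => by
  rw [mul_assoc, ht, hs, mul_assoc]

theorem IsWeaklySubsemigroupSeparable.profinitelyClosed_preimage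
    (hS : IsWeaklySubsemigroupSeparable S) {e : Γ → S} (hl : ∀ c, ∃ l, LeftActsAs e l c)
    (Y : Finset S) :
    ProfinitelyClosed (e ⁻¹' (Subsemigroup.closure (Y : Set S) : Set S)) := by
  intro g hg
  obtain ⟨U, _, _, f, hf⟩ := hS _ ⟨Y, rfl⟩ (e g) hg
  have key : ∀ a b, f (e a) = f (e b) → ∀ d, f (e (d * a)) = f (e (d * b)) := by
    intro a b hab d
    obtain ⟨l, hl⟩ := hl d
    rw [← hl a, ← hl b, map_mul, map_mul, hab]
  let N : Subgroup Γ :=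
    { carrier := {c | f (e c) = f (e 1)}
      one_mem' := rfl
      mul_mem' := fun {a b} ha hb => (key b 1 hb a).trans (by simpa using ha)
      inv_mem' := fun {a} ha => by simpa using (key a 1 ha a⁻¹).symm }
  refine ⟨N, ?_, fun n hn h => hf ⟨_, h, by simpa using key n 1 hn g⟩⟩
  rw [Subgroup.finiteIndex_iff_finite_quotient]
  refine Finite.of_injective
    (fun q : Γ ⧸ N => f (e q.out)) fun p q hpq => ?_
  rw [← QuotientGroup.out_eq' p, ← QuotientGroup.out_eq' q]
  refine QuotientGroup.eq.2 ?_
  change f (e _) = f (e 1)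
  simpa using (key _ _ hpq p.out⁻¹).symm

theorem IsWeaklySubsemigroupSeparable.mulOpposite (hS : IsWeaklySubsemigroupSeparable S) :
    IsWeaklySubsemigroupSeparable Sᵐᵒᵖ := by
  classical
  rintro _ ⟨Y, rfl⟩ s hs
  have hY : (Subsemigroup.closure (Y : Set Sᵐᵒᵖ)).unop =
      Subsemigroup.closure ((Y.image MulOpposite.unop : Finset S) : Set S) := by
    rw [Subsemigroup.unop_closure]
    congr 1
    ext t
    simp only [Set.mem_preimage, Finset.mem_coe, Finset.coe_image, Set.mem_image]
    exact ⟨fun h => ⟨_, h, rfl⟩, fun ⟨u, hu, h⟩ => h ▸ hu⟩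
  obtain ⟨U, _, _, f, hf⟩ := hS _ ⟨_, hY⟩ s.unop (by simpa using hs)
  refine ⟨Uᵐᵒᵖ, inferInstance, Finite.of_equiv U MulOpposite.opEquiv, MulHom.op f, ?_⟩
  rintro ⟨t, ht, hts⟩
  exact hf ⟨t.unop, ht, MulOpposite.op_injective hts⟩

/-- If `e 1` is not of the form `a * e 1 * e 1`, then neither is any `e γ` a left multiple of
a product of `e 1` and another `e δ`. -/
theorem mul_mul_ne_of_actions {e : Γ → S} (hr : ∀ c, ∃ p, RightActsAs e p c)
    (hl : ∀ c, ∃ l, LeftActsAs e l c) (hx : ∀ a, a * e 1 * e 1 ≠ e 1) (a : S) (d c : Γ) :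
    a * e 1 * e d ≠ e c := by
  intro h
  obtain ⟨p, hp⟩ := hr d⁻¹
  obtain ⟨l, hl⟩ := hl (c * d⁻¹)⁻¹
  apply hx (l * a)
  have h1 : a * e 1 * e 1 = e (c * d⁻¹) := by
    rw [← hp c, ← h, mul_assoc _ (e d), hp d, mul_inv_cancel]
  rw [mul_assoc l, mul_assoc l, h1, hl, inv_mul_cancel]

theorem mul_ne_of_actions {e : Γ → S} (hr : ∀ c, ∃ p, RightActsAs e p c)
    (hl : ∀ c, ∃ l, LeftActsAs e l c) (hx : ∀ a, a * e 1 * e 1 ≠ e 1) (b d c : Γ) :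
    e b * e d ≠ e c := by
  obtain ⟨l, hlb⟩ := hl b
  have := mul_mul_ne_of_actions hr hl hx l d c
  rwa [hlb 1, mul_one] at this

/-- To control which translates `e γ` lie in a subsemigroup generated by `e 1` and a set `F`, it
suffices to cover the products involving exactly one factor `e 1` by a set `B` and the products of
elements of `F` by a set `A` of elements acting on the right. -/
theorem mem_of_mem_closure_insert {e : Γ → S} (hr : ∀ c, ∃ p, RightActsAs e p c)
    (hl : ∀ c, ∃ l, LeftActsAs e l c) (hx : ∀ a, a * e 1 * e 1 ≠ e 1) {F A B : Set S}
    (hF : F ⊆ A) (hA : ∀ a ∈ A, ∃ c, RightActsAs e a c) (hAA : ∀ a ∈ A, ∀ b ∈ A, a * b ∈ A)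
    (hB : e 1 ∈ B) (hAB : ∀ a ∈ A, ∀ b ∈ B, a * b ∈ B) (hBA : ∀ b ∈ B, ∀ a ∈ A, b * a ∈ B)
    (hB' : ∀ b ∈ B, ∃ c, b = e c ∨ ∃ u ∈ A, b = u * e c) {c : Γ}
    (hc : e c ∈ Subsemigroup.closure (insert (e 1) F)) : e c ∈ B := by
  let P : S → Prop := fun t => ∃ a d, t = a * e 1 * e d
  have hP_left : ∀ a t, P t → P (a * t) := by
    rintro a _ ⟨b, d, rfl⟩
    exact ⟨a * b, d, by simp only [mul_assoc]⟩
  have hP_mul : ∀ b d, P (e b * e d) := fun b d => by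
    obtain ⟨l, hlb⟩ := hl b
    refine ⟨l, d, ?_⟩
    rw [hlb, mul_one]
  have hB_eq : ∀ d, ∀ b ∈ B, ∃ d' c, e d * b = e d' * e c := by
    intro d b hb
    obtain ⟨c, rfl | ⟨u, hu, rfl⟩⟩ := hB' b hb
    · exact ⟨d, c, rfl⟩
    · obtain ⟨k, hk⟩ := hA u hu
      exact ⟨d * k, c, by rw [← mul_assoc, hk]⟩
  have hP_B : ∀ t b, P t → b ∈ B → P (t * b) := by
    rintro _ b ⟨a, d, rfl⟩ hb
    obtain ⟨d', c, h⟩ := hB_eq d b hb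
    rw [mul_assoc, h]
    exact hP_left _ _ (hP_mul _ _)
  have hP_A : ∀ t b, P t → b ∈ A → P (t * b) := by
    rintro _ b ⟨a, d, rfl⟩ hb
    obtain ⟨k, hk⟩ := hA b hb
    exact ⟨a, d * k, by rw [mul_assoc, hk]⟩
  have hP_BB : ∀ b₁ ∈ B, ∀ b₂ ∈ B, P (b₁ * b₂) := by
    intro b₁ h₁ b₂ h₂
    obtain ⟨c, rfl | ⟨u, -, rfl⟩⟩ := hB' b₁ h₁
    all_goals obtain ⟨d', c', h⟩ := hB_eq c b₂ h₂
    · rw [h]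
      exact hP_mul _ _
    · rw [mul_assoc, h]
      exact hP_left _ _ (hP_mul _ _)
  have main : ∀ t ∈ Subsemigroup.closure (insert (e 1) F), t ∈ A ∨ t ∈ B ∨ P t := by
    intro t ht
    induction ht using Subsemigroup.closure_induction with
    | mem t ht =>
      rcases ht with rfl | ht
      · exact .inr (.inl hB)
      · exact .inl (hF ht)
    | mul s t _ _ hs ht =>
      rcases ht with ht | ht | ht
      · rcases hs with hs | hs | hs
        · exact .inl (hAA s hs t ht)
        · exact .inr (.inl (hBA s hs t ht))
        · exact .inr (.inr (hP_A s t hs ht))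
      · rcases hs with hs | hs | hs
        · exact .inr (.inl (hAB s hs t ht))
        · exact .inr (.inr (hP_BB s hs t ht))
        · exact .inr (.inr (hP_B s t hs ht))
      · exact .inr (.inr (hP_left s t ht))
  rcases main _ hc with h | h | ⟨a, d, h⟩
  · obtain ⟨k, hk⟩ := hA _ h
    exact absurd (hk 1) (mul_ne_of_actions hr hl hx _ _ _)
  · exact h
  · exact absurd h.symm (mul_mul_ne_of_actions hr hl hx _ _ _)

/-- Every element of the group is of finite order, or has a power acting on the right in the same
way as an element that acts on the left as another power. -/
theorem exists_power_acting_on_both_sides (hS : IsWeaklySubsemigroupSeparable S) {e : Γ → S}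
    (he : Function.Injective e) (hr : ∀ c, ∃ p, RightActsAs e p c)
    (hl : ∀ c, ∃ l, LeftActsAs e l c) (hx : ∀ a, a * e 1 * e 1 ≠ e 1) (c : Γ) :
    ∃ k : ℕ, 0 < k ∧ (c ^ k = 1 ∨
      ∃ u, RightActsAs e u (c ^ k) ∧ ∃ l ∈ Subgroup.zpowers c, LeftActsAs e u l) := by
  classical
  obtain ⟨s, hs⟩ := hr c
  have hcl := hS.profinitelyClosed_preimage hl {e 1, s}
  have hpow : ∀ k : ℕ, e (c ^ k) ∈ Subsemigroup.closure (({e 1, s} : Finset S) : Set S) := by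
    intro k
    induction k with
    | zero => exact Subsemigroup.subset_closure (by simp)
    | succ k ih =>
      rw [pow_succ, ← hs]
      exact mul_mem ih (Subsemigroup.subset_closure (by simp))
  have hinv := hcl.inv_mem hpow
  rw [Finset.coe_insert, Finset.coe_singleton] at hinv
  let A : Set S := {u | ∃ k : ℕ, 0 < k ∧ RightActsAs e u (c ^ k)}
  let B : Set S := {b | ∃ n : ℕ, b = e (c ^ n) ∨ ∃ u ∈ A, b = u * e (c ^ n)}
  have hAA : ∀ a ∈ A, ∀ b ∈ A, a * b ∈ A := by
    rintro a ⟨k, hk, ha⟩ b ⟨m, -, hb⟩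
    exact ⟨k + m, by omega, pow_add c k m ▸ ha.mul hb⟩
  have hmem : e c⁻¹ ∈ B := by
    refine mem_of_mem_closure_insert (A := A) (B := B) hr hl hx ?_ ?_ hAA ?_ ?_ ?_ ?_ hinv
    · rintro _ rfl
      exact ⟨1, one_pos, by rwa [pow_one]⟩
    · rintro a ⟨k, -, ha⟩
      exact ⟨_, ha⟩
    · exact ⟨0, .inl (by rw [pow_zero])⟩
    · rintro a ha _ ⟨n, rfl | ⟨u, hu, rfl⟩⟩
      · exact ⟨n, .inr ⟨a, ha, rfl⟩⟩
      · exact ⟨n, .inr ⟨a * u, hAA _ ha _ hu, (mul_assoc _ _ _).symm⟩⟩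
    · rintro _ ⟨n, rfl | ⟨u, hu, rfl⟩⟩ a ⟨k, -, ha⟩
      · exact ⟨n + k, .inl (by rw [ha, pow_add])⟩
      · exact ⟨n + k, .inr ⟨u, hu, by rw [mul_assoc, ha, pow_add]⟩⟩
    · rintro _ ⟨n, h⟩
      exact ⟨_, h⟩
  obtain ⟨n, h | ⟨u, ⟨k, hk, hu⟩, h⟩⟩ := hmem
  · refine ⟨n + 1, n.succ_pos, .inl ?_⟩
    rw [pow_succ, ← he h, inv_mul_cancel]
  · refine ⟨k, hk, .inr ⟨u, hu, c⁻¹ * (c ^ n)⁻¹, ?_, fun d => ?_⟩⟩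
    · exact mul_mem (inv_mem (Subgroup.mem_zpowers c))
        (inv_mem (pow_mem (Subgroup.mem_zpowers c) n))
    · obtain ⟨p, hp⟩ := hr ((c ^ n)⁻¹ * d)
      have := hp (c ^ n)
      rw [mul_inv_cancel_left] at this
      rw [← this, ← mul_assoc, ← h, hp, mul_assoc]

theorem isWeaklySubgroupSeparable_of_actions (hS : IsWeaklySubsemigroupSeparable S) {e : Γ → S}
    (he : Function.Injective e) (hr : ∀ c, ∃ p, RightActsAs e p c)
    (hl : ∀ c, ∃ l, LeftActsAs e l c) (hx : ∀ a, a * e 1 * e 1 ≠ e 1) :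
    IsWeaklySubgroupSeparable Γ := by
  classical
  refine isWeaklySubgroupSeparable_of_profinitelyClosed fun X => ?_
  have hdata : ∀ c : Γ, ∃ (k : ℕ) (l : Γ) (Y : Finset S), 0 < k ∧ l ∈ Subgroup.zpowers c ∧
      (∀ u ∈ Y, RightActsAs e u (c ^ k) ∧ LeftActsAs e u l) ∧
      ((c ^ k = 1 ∧ l = 1) ∨ Y.Nonempty) := by
    intro c
    obtain ⟨k, hk, h | ⟨u, hu, l, hlc, hul⟩⟩ :=
      exists_power_acting_on_both_sides hS he hr hl hx c
    · exact ⟨k, 1, ∅, hk, one_mem _, by simp, .inl ⟨h, rfl⟩⟩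
    · exact ⟨k, l, {u}, hk, hlc, by simpa using ⟨hu, hul⟩, .inr (by simp)⟩
  choose k l Y hk hlc hY hne using hdata
  let F : Finset S := X.biUnion Y
  let G : Set Γ := {g | ∃ c ∈ X, g = c ^ k c ∨ g = l c}
  let M : Submonoid Γ := Submonoid.closure G
  let A : Set S := {u | (∃ r ∈ M, RightActsAs e u r) ∧ ∃ m ∈ M, LeftActsAs e u m}
  have hmem : ∀ m ∈ M, e m ∈ Subsemigroup.closure ((insert (e 1) F : Finset S) : Set S) := by
    intro m hm
    induction hm using Submonoid.closure_induction_right with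
    | one => exact Subsemigroup.subset_closure (by simp)
    | mul_right m _ g hg ih =>
      obtain ⟨c, hc, hg⟩ := hg
      rcases hne c with ⟨h₁, h₂⟩ | ⟨u, hu⟩
      · rcases hg with rfl | rfl
        · rwa [h₁, mul_one]
        · rwa [h₂, mul_one]
      · have huT : u ∈ Subsemigroup.closure ((insert (e 1) F : Finset S) : Set S) :=
          Subsemigroup.subset_closure (Finset.mem_insert_of_mem (Finset.mem_biUnion.2 ⟨c, hc, hu⟩))
        rcases hg with rfl | rfl
        · rw [← (hY c u hu).1]
          exact mul_mem ih huT
        · rw [mul_comm, ← (hY c u hu).2]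
          exact mul_mem huT ih
  have hmem' : ∀ g, e g ∈ Subsemigroup.closure ((insert (e 1) F : Finset S) : Set S) → g ∈ M := by
    intro g hg
    rw [Finset.coe_insert] at hg
    have : e g ∈ e '' M := by
      refine mem_of_mem_closure_insert (A := A) hr hl hx ?_ ?_ ?_ ?_ ?_ ?_ ?_ hg
      · intro u hu
        obtain ⟨c, hc, hu⟩ := Finset.mem_biUnion.1 hu
        exact ⟨⟨_, Submonoid.subset_closure ⟨c, hc, .inl rfl⟩, (hY c u hu).1⟩,
          ⟨_, Submonoid.subset_closure ⟨c, hc, .inr rfl⟩, (hY c u hu).2⟩⟩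
      · rintro a ⟨⟨r, -, ha⟩, -⟩
        exact ⟨r, ha⟩
      · rintro a ⟨⟨r, hr, ha⟩, m, hm, ha'⟩ b ⟨⟨r', hr', hb⟩, m', hm', hb'⟩
        exact ⟨⟨_, mul_mem hr hr', ha.mul hb⟩, _, mul_mem hm hm', ha'.mul hb'⟩
      · exact ⟨1, one_mem M, rfl⟩
      · rintro a ⟨-, m, hm, ha⟩ _ ⟨b, hb, rfl⟩
        exact ⟨_, mul_mem hm hb, (ha b).symm⟩
      · rintro _ ⟨b, hb, rfl⟩ a ⟨⟨r, hr, ha⟩, -⟩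
        exact ⟨_, mul_mem hb hr, (ha b).symm⟩
      · rintro _ ⟨b, -, rfl⟩
        exact ⟨b, .inl rfl⟩
    obtain ⟨m, hm, h⟩ := this
    exact he h ▸ hm
  have hM : ProfinitelyClosed (M : Set Γ) := by
    have := hS.profinitelyClosed_preimage hl (insert (e 1) F)
    convert this using 1
    exact Set.ext fun g => ⟨hmem g, hmem' g⟩
  obtain ⟨K, hK⟩ := hM.exists_subgroup
  have hKM : (K : Set Γ) = M := congrArg SetLike.coe hK
  refine ProfinitelyClosed.of_torsion_quotient (M := K) (hKM ▸ hM) X.finite_toSet ?_ ?_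
  · have : M ≤ (Subgroup.closure (X : Set Γ)).toSubmonoid := by
      refine Submonoid.closure_le.2 ?_
      have hcX : ∀ c ∈ X, c ∈ Subgroup.closure (X : Set Γ) := fun c hc =>
        Subgroup.subset_closure hc
      rintro g ⟨c, hc, rfl | rfl⟩
      · exact pow_mem (hcX c hc) _
      · exact Subgroup.zpowers_le.2 (hcX c hc) (hlc c)
    rw [← hK] at this
    exact this
  · intro c hc
    refine ⟨k c, hk c, ?_⟩
    have : c ^ k c ∈ M := Submonoid.subset_closure ⟨c, hc, .inl rfl⟩
    rwa [← hK] at this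

/-- The dual of `isWeaklySubgroupSeparable_of_actions`. -/
theorem isWeaklySubgroupSeparable_of_actions' (hS : IsWeaklySubsemigroupSeparable S) {e : Γ → S}
    (he : Function.Injective e) (hr : ∀ c, ∃ p, RightActsAs e p c)
    (hl : ∀ c, ∃ l, LeftActsAs e l c) (hx : ∀ a, e 1 * e 1 * a ≠ e 1) :
    IsWeaklySubgroupSeparable Γ := by
  refine isWeaklySubgroupSeparable_of_actions (e := MulOpposite.op ∘ e) hS.mulOpposite
    (MulOpposite.op_injective.comp he) (fun c => ?_) (fun c => ?_) (fun a h => ?_)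
  · obtain ⟨l, hl⟩ := hl c
    exact ⟨.op l, fun d => MulOpposite.unop_injective ((hl d).trans (congrArg e (mul_comm _ _)))⟩
  · obtain ⟨p, hp⟩ := hr c
    exact ⟨.op p, fun d => MulOpposite.unop_injective ((hp d).trans (congrArg e (mul_comm _ _)))⟩
  · exact hx a.unop ((mul_assoc _ _ _).trans (congrArg MulOpposite.unop h))

theorem isWeaklySubgroupSeparable_of_mul_mem (hS : IsWeaklySubsemigroupSeparable S) {e : Γ → S}
    (he : Function.Injective e) (hr : ∀ c, ∃ p, RightActsAs e p c)
    (hl : ∀ c, ∃ l, LeftActsAs e l c) {z : Γ} (hz : e 1 * e 1 = e z) :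
    IsWeaklySubgroupSeparable Γ := by
  classical
  have hmul : ∀ a b, e a * e b = e (a * z * b) := by
    intro a b
    obtain ⟨l, hla⟩ := hl a
    obtain ⟨p, hpb⟩ := hr b
    have ha := hla 1
    have hb := hpb 1
    rw [mul_one] at ha
    rw [one_mul] at hb
    rw [← ha, ← hb, mul_assoc, ← mul_assoc (e 1), hz, hpb, hla, mul_assoc]
  have hmul' : ∀ a b, e (z⁻¹ * a) * e (z⁻¹ * b) = e (z⁻¹ * (a * b)) := by
    intro a b
    rw [hmul]
    congr 1
    rw [mul_assoc, mul_inv_cancel_left, mul_assoc]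
  refine isWeaklySubgroupSeparable_of_profinitelyClosed fun X => ?_
  obtain ⟨Z, hZ⟩ := (Subgroup.fg_iff_submonoid_fg _).1 ⟨X, rfl⟩
  have hZ' : ∀ g, g ∈ Subgroup.closure (X : Set Γ) ↔ g ∈ Submonoid.closure (Z : Set Γ) :=
    fun g => by rw [hZ, Subgroup.mem_toSubmonoid]
  let Y : Finset S := (insert 1 Z).image fun g => e (z⁻¹ * g)
  have hY : ∀ g ∈ insert 1 Z, e (z⁻¹ * g) ∈ Subsemigroup.closure (Y : Set S) := fun g hg =>
    Subsemigroup.subset_closure (Finset.mem_image_of_mem _ hg)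
  refine (hS.profinitelyClosed_preimage hl Y).of_smul z⁻¹ fun g => ⟨fun hg => ?_, fun hg => ?_⟩
  · change e (z⁻¹ * g) ∈ Subsemigroup.closure (Y : Set S)
    replace hg : g ∈ Submonoid.closure (Z : Set Γ) := (hZ' g).1 hg
    induction hg using Submonoid.closure_induction_right with
    | one => exact hY 1 (Finset.mem_insert_self _ _)
    | mul_right m _ g hg ih =>
      rw [← hmul']
      exact mul_mem ih (hY g (Finset.mem_insert_of_mem hg))
  · have key : ∀ t ∈ Subsemigroup.closure (Y : Set S),
        ∃ k ∈ Submonoid.closure (Z : Set Γ), t = e (z⁻¹ * k) := by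
      intro t ht
      induction ht using Subsemigroup.closure_induction with
      | mem t ht =>
        obtain ⟨k, hk, rfl⟩ := Finset.mem_image.1 ht
        refine ⟨k, ?_, rfl⟩
        rcases Finset.mem_insert.1 hk with rfl | hk
        · exact one_mem _
        · exact Submonoid.subset_closure hk
      | mul s t _ _ hs ht =>
        obtain ⟨a, ha, rfl⟩ := hs
        obtain ⟨b, hb, rfl⟩ := ht
        exact ⟨a * b, mul_mem ha hb, hmul' a b⟩
    obtain ⟨k, hk, h⟩ := key _ hg
    rw [mul_left_cancel (he h)]
    exact (hZ' k).2 hk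

end Actions

section Schutzenberger

variable {S : Type*} [Semigroup S]

theorem mem_insert_right_multiples {x z : S} :
    z ∈ insert x {z : S | ∃ s : S, z = x * s} ↔ ∃ s : WithOne S, (z : WithOne S) = x * s := by
  constructor
  · rintro (rfl | ⟨s, rfl⟩)
    · exact ⟨1, (mul_one _).symm⟩
    · exact ⟨s, WithOne.coe_mul _ _⟩
  · rintro ⟨s, hs⟩
    induction s using WithOne.recOneCoe with
    | one => exact .inl (WithOne.coe_inj.1 (by rwa [mul_one] at hs))
    | coe s => exact .inr ⟨s, WithOne.coe_inj.1 (by rwa [WithOne.coe_mul])⟩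

theorem mem_insert_left_multiples {x z : S} :
    z ∈ insert x {z : S | ∃ s : S, z = s * x} ↔ ∃ s : WithOne S, (z : WithOne S) = s * x := by
  constructor
  · rintro (rfl | ⟨s, rfl⟩)
    · exact ⟨1, (one_mul _).symm⟩
    · exact ⟨s, WithOne.coe_mul _ _⟩
  · rintro ⟨s, hs⟩
    induction s using WithOne.recOneCoe with
    | one => exact .inl (WithOne.coe_inj.1 (by rwa [one_mul] at hs))
    | coe s => exact .inr ⟨s, WithOne.coe_inj.1 (by rwa [WithOne.coe_mul])⟩

/-- Green's relation H in terms of multiplication in `WithOne S`. -/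
theorem greenH_iff {x y : S} : GreenH x y ↔
    ((∃ s : WithOne S, (y : WithOne S) = x * s) ∧ ∃ t : WithOne S, (x : WithOne S) = y * t) ∧
    ((∃ s : WithOne S, (y : WithOne S) = s * x) ∧ ∃ t : WithOne S, (x : WithOne S) = t * y) := by
  constructor
  · rintro ⟨hR, hL⟩
    refine ⟨⟨?_, ?_⟩, ?_, ?_⟩
    · exact mem_insert_right_multiples.1 (hR ▸ Set.mem_insert y _)
    · exact mem_insert_right_multiples.1 (hR ▸ Set.mem_insert x _)
    · exact mem_insert_left_multiples.1 (hL ▸ Set.mem_insert y _)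
    · exact mem_insert_left_multiples.1 (hL ▸ Set.mem_insert x _)
  · rintro ⟨⟨⟨s, hs⟩, t, ht⟩, ⟨u, hu⟩, v, hv⟩
    constructor
    · ext z
      rw [mem_insert_right_multiples, mem_insert_right_multiples]
      constructor
      · rintro ⟨w, hw⟩
        exact ⟨t * w, by rw [hw, ht, mul_assoc]⟩
      · rintro ⟨w, hw⟩
        exact ⟨s * w, by rw [hw, hs, mul_assoc]⟩
    · ext z
      rw [mem_insert_left_multiples, mem_insert_left_multiples]
      constructor
      · rintro ⟨w, hw⟩
        exact ⟨w * v, by rw [hw, hv, mul_assoc]⟩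
      · rintro ⟨w, hw⟩
        exact ⟨w * u, by rw [hw, hu, mul_assoc]⟩

theorem GreenH.refl (x : S) : GreenH x x := ⟨rfl, rfl⟩

theorem GreenH.symm {x y : S} (h : GreenH x y) : GreenH y x := ⟨h.1.symm, h.2.symm⟩

theorem GreenH.trans {x y z : S} (h : GreenH x y) (h' : GreenH y z) : GreenH x z :=
  ⟨h.1.trans h'.1, h.2.trans h'.2⟩

/-- A case of Green's lemma: an element translating `x` inside its H-class translates the whole
H-class, and is inverted by any element translating `x` back. -/
theorem GreenH.exists_mul {x y h : S} {s t : WithOne S} (hxy : GreenH x y)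
    (hs : (y : WithOne S) = x * s) (ht : (x : WithOne S) = y * t) (hxh : GreenH x h) :
    ∃ k : S, (k : WithOne S) = h * s ∧ GreenH x k ∧ (k : WithOne S) * t = h := by
  obtain ⟨-, ⟨u, hu⟩, v, hv⟩ := greenH_iff.1 hxh
  obtain ⟨k, hk⟩ : ∃ k : S, (k : WithOne S) = h * s := by
    induction s using WithOne.recOneCoe with
    | one => exact ⟨h, (mul_one _).symm⟩
    | coe s => exact ⟨h * s, WithOne.coe_mul _ _⟩
  have hky : (k : WithOne S) = u * y := by rw [hk, hu, hs, mul_assoc]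
  have hkt : (k : WithOne S) * t = h := by rw [hky, mul_assoc, ← ht, hu]
  obtain ⟨-, ⟨a, ha⟩, b, hb⟩ := greenH_iff.1 hxy
  have hyk : (y : WithOne S) = v * k := by rw [hk, ← mul_assoc, ← hv, hs]
  refine ⟨k, hk, hxh.trans ⟨?_, hxh.symm.2.trans (hxy.2.trans ?_)⟩, hkt⟩
  · ext z
    rw [mem_insert_right_multiples, mem_insert_right_multiples]
    constructor
    · rintro ⟨w, hw⟩
      exact ⟨t * w, by rw [hw, ← hkt, mul_assoc]⟩
    · rintro ⟨w, hw⟩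
      exact ⟨s * w, by rw [hw, hk, mul_assoc]⟩
  · ext z
    rw [mem_insert_left_multiples, mem_insert_left_multiples]
    constructor
    · rintro ⟨w, hw⟩
      exact ⟨w * v, by rw [hw, hyk, mul_assoc]⟩
    · rintro ⟨w, hw⟩
      exact ⟨w * u, by rw [hw, hky, mul_assoc]⟩

theorem mem_schStab_of_greenH {x y : S} {s : WithOne S} (hxy : GreenH x y)
    (hs : (y : WithOne S) = x * s) : s ∈ SchStab (HClass x) := by
  obtain ⟨⟨-, t, ht⟩, -⟩ := greenH_iff.1 hxy
  apply Set.Subset.antisymm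
  · rintro _ ⟨_, ⟨h, hh, rfl⟩, rfl⟩
    obtain ⟨k, hk, hxk, -⟩ := hxy.exists_mul hs ht hh
    exact ⟨k, hxk, hk⟩
  · rintro _ ⟨h, hh, rfl⟩
    obtain ⟨k, hk, hyk, hks⟩ := hxy.symm.exists_mul ht hs (hxy.symm.trans hh)
    exact ⟨k, ⟨k, hxy.trans hyk, rfl⟩, hks⟩

theorem coe_mul_mem_of_mem_schStab {H : Set S} {h : S} (hh : h ∈ H) (p : SchStab H) :
    ∃ k ∈ H, (k : WithOne S) = h * (p : WithOne S) := by
  have : (h : WithOne S) * (p : WithOne S) ∈ (fun x : S => (x : WithOne S)) '' H := by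
    rw [← show (fun h => h * (p : WithOne S)) '' ((fun x : S => (x : WithOne S)) '' H) =
      (fun x : S => (x : WithOne S)) '' H from p.2]
    exact ⟨h, ⟨h, hh, rfl⟩, rfl⟩
  exact this

/-- The Schützenberger group acts regularly on its H-class: `e γ` is the image of the base point
under `γ`. The right action is realised by right multiplication and commutes with left
multiplications that realise the left regular action. -/
theorem IsSchutzenbergerGroup.exists_regular_action {x : S} {Γ : Type*} [Group Γ]
    {φ : SchStab (HClass x) →* Γ} (hφ : IsSchutzenbergerGroup (HClass x) Γ φ) :
    ∃ e : Γ → S, Function.Injective e ∧ e 1 = x ∧ Set.range e = HClass x ∧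
      (∀ c, ∃ p : WithOne S, ∀ d, (e d : WithOne S) * p = e (d * c)) ∧
      ∀ c, ∃ l : WithOne S, ∀ d, l * (e d : WithOne S) = e (c * d) := by
  have hxx : x ∈ HClass x := GreenH.refl x
  choose p hp using hφ.1
  choose e heH he using fun c => coe_mul_mem_of_mem_schStab hxx (p c)
  have he' : ∀ a c, φ a = c → (x : WithOne S) * (a : WithOne S) = e c := fun a c hac => by
    rw [he c]
    exact (hφ.2 a (p c)).1 (hac.trans (hp c).symm) x hxx
  have hmul : ∀ c d, (e d : WithOne S) * (p c : WithOne S) = e (d * c) := fun c d => by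
    rw [← he' (p d * p c) (d * c) (by rw [map_mul, hp, hp]), he d, Submonoid.coe_mul, mul_assoc]
  refine ⟨e, fun c d hcd => ?_, ?_, ?_, fun c => ⟨p c, hmul c⟩, fun c => ?_⟩
  · rw [← hp c, ← hp d, hφ.2]
    intro h hh
    obtain ⟨-, ⟨u, hu⟩, -⟩ := greenH_iff.1 hh
    rw [hu, mul_assoc, mul_assoc, ← he, ← he, hcd]
  · rw [← WithOne.coe_inj, ← he' 1 1 (map_one φ), Submonoid.coe_one, mul_one]
  · refine Set.Subset.antisymm (Set.range_subset_iff.2 heH) fun y hy => ?_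
    obtain ⟨⟨⟨s, hs⟩, -⟩, -⟩ := greenH_iff.1 hy
    refine ⟨φ ⟨s, mem_schStab_of_greenH hy hs⟩, WithOne.coe_inj.1 ?_⟩
    rw [← he' _ _ rfl, hs]
  · obtain ⟨-, ⟨l, hl⟩, -⟩ := greenH_iff.1 (heH c)
    refine ⟨l, fun d => ?_⟩
    rw [he d, ← mul_assoc, ← hl, hmul]

/-- If nontrivial, an action by elements of `WithOne S` is an action by elements of `S`. -/
theorem exists_coe_of_forall_exists_withOne {Γ : Type*} [Group Γ] [Nontrivial Γ]
    {P : WithOne S → Γ → Prop} (h : ∀ c, ∃ p, P p c) (h1 : ∀ c, P 1 c → c = 1)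
    (hmul : ∀ p q c d, P p c → P q d → P (p * q) (c * d)) (c : Γ) : ∃ p : S, P p c := by
  have hne : ∀ c : Γ, c ≠ 1 → ∃ p : S, P p c := fun c hc => by
    obtain ⟨p, hp⟩ := h c
    induction p using WithOne.recOneCoe with
    | one => exact absurd (h1 c hp) hc
    | coe p => exact ⟨p, hp⟩
  by_cases hc : c = 1
  · obtain ⟨d, hd⟩ := exists_ne (1 : Γ)
    obtain ⟨p, hp⟩ := hne d hd
    obtain ⟨q, hq⟩ := hne d⁻¹ (inv_ne_one.2 hd)
    refine ⟨p * q, ?_⟩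
    have := hmul _ _ _ _ hp hq
    rwa [mul_inv_cancel, ← hc, ← WithOne.coe_mul] at this
  · exact hne c hc

end Schutzenberger

theorem schutzenberger_abelian_weakly_subgroup_separable (S : Type*) [Semigroup S]
    (hS : IsWeaklySubsemigroupSeparable S) (x : S)
    (Γ : Type*) [Group Γ] (φ : SchStab (HClass x) →* Γ)
    (hφ : IsSchutzenbergerGroup (HClass x) Γ φ)
    (hab : ∀ a b : Γ, a * b = b * a) :
    IsWeaklySubgroupSeparable Γ := by
  rcases subsingleton_or_nontrivial Γ with hΓ | hΓ
  · intro H _ g hg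
    exact absurd (Subsingleton.elim 1 g ▸ one_mem H) hg
  obtain ⟨e, he, hx, hrange, hr, hl⟩ := hφ.exists_regular_action
  let _ : CommGroup Γ := { ‹Group Γ› with mul_comm := hab }
  have hr' : ∀ c, ∃ p, RightActsAs e p c := fun c => by
    obtain ⟨p, hp⟩ := exists_coe_of_forall_exists_withOne
      (P := fun (p : WithOne S) c => ∀ d, (e d : WithOne S) * p = (e (d * c) : S)) hr
      (fun c hc => by simpa [he.eq_iff, eq_comm] using hc 1)
      (fun p q c d hp hq a => by rw [← mul_assoc, hp, hq, mul_assoc]) c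
    exact ⟨p, fun d => WithOne.coe_inj.1 ((WithOne.coe_mul _ _).trans (hp d))⟩
  have hl' : ∀ c, ∃ l, LeftActsAs e l c := fun c => by
    obtain ⟨l, hl⟩ := exists_coe_of_forall_exists_withOne
      (P := fun (l : WithOne S) c => ∀ d, l * (e d : WithOne S) = e (c * d)) hl
      (fun c hc => by simpa [he.eq_iff, eq_comm] using hc 1)
      (fun p q c d hp hq a => by rw [mul_assoc, hq, hp, mul_assoc]) c
    exact ⟨l, fun d => WithOne.coe_inj.1 ((WithOne.coe_mul _ _).trans (hl d))⟩
  by_cases hleft : ∀ a, a * e 1 * e 1 ≠ e 1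
  · exact isWeaklySubgroupSeparable_of_actions hS he hr' hl' hleft
  by_cases hright : ∀ a, e 1 * e 1 * a ≠ e 1
  · exact isWeaklySubgroupSeparable_of_actions' hS he hr' hl' hright
  push Not at hleft hright
  obtain ⟨a, ha⟩ := hleft
  obtain ⟨b, hb⟩ := hright
  have hxx : e 1 * e 1 ∈ Set.range e := by
    rw [hrange, ← hx]
    refine greenH_iff.2 ⟨⟨⟨_, WithOne.coe_mul _ _⟩, b, ?_⟩, ⟨_, WithOne.coe_mul _ _⟩, a, ?_⟩
    · rw [← WithOne.coe_mul, hb]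
    · rw [← WithOne.coe_mul, ← mul_assoc, ha]
  obtain ⟨z, hz⟩ := hxx
  exact isWeaklySubgroupSeparable_of_mul_mem hS he hr' hl' hz.symm
end

section
/- Let S be a finitely generated commutative semigroup. Then the following are equivalent: (1) S is completely separable; (2) S is strongly subsemigroup separable; (3) S is weakly subsemigroup separable; (4) every H-class of S is finite. -/
open scoped Pointwise

section CommMonoid

variable {M : Type*} [CommMonoid M]

theorem Monoid.FG.wellQuasiOrdered_dvd [hM : Monoid.FG M] :
    WellQuasiOrdered (fun a b : M => a ∣ b) := by
  obtain ⟨Y, hY⟩ := hM.fg_top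
  intro f
  have hf : ∀ n, ∃ a : Y → ℕ, f n = ∏ i : Y, i.1 ^ a i := fun n =>
    Submonoid.mem_closure_finset'.1 (hY ▸ Submonoid.mem_top (f n))
  choose a ha using hf
  obtain ⟨m, n, hmn, hle⟩ := (wellQuasiOrdered_le (α := Y → ℕ)) a
  refine ⟨m, n, hmn, ?_⟩
  rw [ha m, ha n]
  exact Finset.prod_dvd_prod_of_dvd _ _ fun i _ => pow_dvd_pow _ (hle i)

/-- For an ideal `I` of a finitely generated commutative monoid, the ascending chain of
quotients `I : xⁿ` stabilises. -/
theorem Monoid.FG.exists_pow_mul_mem_of_pow_succ_mul_mem [Monoid.FG M] (I : Set M)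
    (hI : ∀ a b, a ∣ b → a ∈ I → b ∈ I) (x : M) :
    ∃ N, ∀ n ≥ N, ∀ c, x ^ (n + 1) * c ∈ I → x ^ n * c ∈ I := by
  by_contra! h
  obtain ⟨φ, hφ, hc⟩ := Nat.exists_strictMono_subsequence
    (P := fun n => ∃ c, x ^ (n + 1) * c ∈ I ∧ x ^ n * c ∉ I) fun n => by
      obtain ⟨k, hk, hc⟩ := h (n + 1)
      exact ⟨k, hk, hc⟩
  choose c hmem hnot using hc
  obtain ⟨k, l, hkl, hdvd⟩ := Monoid.FG.wellQuasiOrdered_dvd c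
  exact hnot l (hI _ _ (mul_dvd_mul (pow_dvd_pow x (hφ hkl)) hdvd) (hmem k))

theorem Submonoid.finite_powers_of_pow_eq_pow_add {x : M} {n m : ℕ} (hm : 0 < m)
    (h : x ^ n = x ^ (n + m)) : (Submonoid.powers x : Set M).Finite := by
  refine ((Set.finite_Iio (n + m)).image (x ^ ·)).subset ?_
  rintro _ ⟨k, rfl⟩
  induction k using Nat.strong_induction_on with
  | _ k ih =>
    rcases lt_or_ge k (n + m) with hk | hk
    · exact ⟨k, hk, rfl⟩
    · obtain ⟨d, rfl⟩ := Nat.exists_eq_add_of_le hk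
      have key : x ^ (n + m + d) = x ^ (n + d) := by
        rw [pow_add, ← h, ← pow_add]
      have := ih (n + d) (by omega)
      simpa only [key] using this

/-- A finitely generated commutative monoid is finite as soon as it is periodic. -/
theorem Monoid.FG.finite_of_periodic [hM : Monoid.FG M]
    (h : ∀ x : M, ∃ n m, 0 < m ∧ x ^ n = x ^ (n + m)) : Finite M := by
  obtain ⟨Y, hY⟩ := hM.fg_top
  have hfin : ∀ y : Y, Finite (Submonoid.powers y.1) := fun y => by
    obtain ⟨n, m, hm, hp⟩ := h y.1
    exact (Submonoid.finite_powers_of_pow_eq_pow_add hm hp).to_subtype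
  refine Finite.of_surjective
    (fun g : ∀ y : Y, Submonoid.powers y.1 => ∏ y : Y, (g y : M)) fun x => ?_
  obtain ⟨a, rfl⟩ := Submonoid.mem_closure_finset'.1 (hY ▸ Submonoid.mem_top x)
  exact ⟨fun y => ⟨y.1 ^ a y, a y, rfl⟩, rfl⟩

theorem Con.finite_quotient_of_periodic [Monoid.FG M] (c : Con M)
    (h : ∀ x : M, ∃ n m, 0 < m ∧ c (x ^ n) (x ^ (n + m))) : Finite c.Quotient := by
  have : Monoid.FG c.Quotient := Monoid.fg_of_surjective c.mk' Con.mk'_surjective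
  refine Monoid.FG.finite_of_periodic fun q => ?_
  obtain ⟨x, rfl⟩ := Con.mk'_surjective (c := c) q
  obtain ⟨n, m, hm, hx⟩ := h x
  refine ⟨n, m, hm, ?_⟩
  rw [← map_pow, ← map_pow]
  exact (Con.eq c).2 hx

theorem eq_mul_pow_mul_of_eq_mul_mul {x u t : M} (h : t = x * u * t) (n : ℕ) :
    t = x ^ n * (u ^ n * t) := by
  rw [← mul_assoc, ← mul_pow]
  induction n with
  | zero => simp
  | succ n ih => rw [pow_succ, mul_assoc, ← h, ← ih]

/-- If `x` acts invertibly on `t` and the orbit of `t` under `x` has finite image under a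
homomorphism, then some positive power of `x` fixes the image of `t`. -/
theorem MonoidHom.exists_map_pow_mul_eq {V : Type*} [Monoid V] (F : M →* V) {x t : M}
    (hx : x * t ∣ t) (hfin : (Set.range fun i : ℕ => F (x ^ i * t)).Finite) :
    ∃ m, 0 < m ∧ F (x ^ m * t) = F t := by
  obtain ⟨u, hu⟩ := hx
  have hu' : t = x * u * t := by rw [mul_right_comm]; exact hu
  have hninj : ¬ Function.Injective fun i : ℕ => F (x ^ i * t) := fun hinj =>
    Set.infinite_range_of_injective hinj hfin
  obtain ⟨i, j, hij, hne⟩ : ∃ i j, F (x ^ i * t) = F (x ^ j * t) ∧ i < j := by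
    simp only [Function.Injective, not_forall] at hninj
    obtain ⟨i, j, hij, hne⟩ := hninj
    rcases lt_or_gt_of_ne hne with h | h
    · exact ⟨i, j, hij, h⟩
    · exact ⟨j, i, hij.symm, h⟩
  obtain ⟨m, rfl⟩ := Nat.exists_eq_add_of_lt hne
  refine ⟨m + 1, Nat.succ_pos _, ?_⟩
  have ht := eq_mul_pow_mul_of_eq_mul_mul hu' i
  calc F (x ^ (m + 1) * t) = F (x ^ (m + 1) * (x ^ i * (u ^ i * t))) := by rw [← ht]
    _ = F (x ^ (i + m + 1) * t) * F (u ^ i) := by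
        rw [← map_mul]; congr 1; simp only [pow_add]; ac_rfl
    _ = F (x ^ i * (u ^ i * t)) := by
        rw [← hij, ← map_mul]; congr 1; ac_rfl
    _ = F t := by rw [← ht]

/-- The syntactic congruence of a point. -/
def syntacticCon (s : M) : Con M where
  r a b := ∀ c, a * c = s ↔ b * c = s
  iseqv := ⟨fun _ _ => Iff.rfl, fun h c => (h c).symm, fun h k c => (h c).trans (k c)⟩
  mul' := fun {a b c d} hab hcd e => by
    rw [mul_assoc, hab, mul_left_comm, hcd, mul_left_comm, mul_assoc]

/-- The mutual-divisibility class of an element; in a commutative monoid this is its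
`H`-class. -/
def dvdClass (s : M) : Set M := {h | h ∣ s ∧ s ∣ h}

theorem finite_quotient_syntacticCon [Monoid.FG M] (s : M) (hs : (dvdClass s).Finite) :
    Finite (syntacticCon s).Quotient := by
  refine Con.finite_quotient_of_periodic _ fun x => ?_
  obtain ⟨N₁, h₁⟩ := Monoid.FG.exists_pow_mul_mem_of_pow_succ_mul_mem {a | s ∣ a}
    (fun a b hab ha => dvd_trans ha hab) x
  obtain ⟨N₂, h₂⟩ := Monoid.FG.exists_pow_mul_mem_of_pow_succ_mul_mem {a | ¬ a ∣ s}
    (fun a b hab ha hb => ha (dvd_trans hab hb)) x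
  set N := max N₁ N₂
  have h₁' : ∀ m c, s ∣ x ^ (N + m) * c → s ∣ x ^ N * c := by
    intro m c
    induction m with
    | zero => exact id
    | succ m ih => exact fun h => ih (h₁ (N + m) (by omega) c h)
  by_cases hc : ∃ c, x ^ N * c = s
  · obtain ⟨c₀, hc₀⟩ := hc
    have hx : x * s ∣ s := by
      by_contra hcon
      refine h₂ N (le_max_right _ _) c₀ ?_ hc₀.dvd
      rwa [pow_succ', mul_assoc, hc₀]
    obtain ⟨m, hm, hms⟩ := (MonoidHom.id M).exists_map_pow_mul_eq hx <| hs.subset <| by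
      obtain ⟨u, hu⟩ := hx
      have hu' : s = x * u * s := by rw [mul_right_comm]; exact hu
      rintro _ ⟨i, rfl⟩
      refine ⟨⟨u ^ i, ?_⟩, dvd_mul_left _ _⟩
      have := eq_mul_pow_mul_of_eq_mul_mul hu' i
      simpa only [MonoidHom.id_apply, mul_assoc, mul_comm s] using this
    simp only [MonoidHom.id_apply] at hms
    refine ⟨N, m, hm, fun c => ⟨fun h => ?_, fun h => ?_⟩⟩
    · rw [pow_add, mul_comm (x ^ N), mul_assoc, h, hms]
    · obtain ⟨v, hv⟩ := h₁' m c h.symm.dvd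
      rw [pow_add, mul_comm (x ^ N), mul_assoc, hv, ← mul_assoc, hms] at h
      rw [hv, h]
  · refine ⟨N, 1, one_pos, fun c => ⟨fun h => (hc ⟨c, h⟩).elim, fun h => (hc ⟨x * c, ?_⟩).elim⟩⟩
    rw [← mul_assoc, ← pow_succ, h]

/-- The congruence identifying elements acting in the same way on `s`, where everything
that moves `s` out of its `H`-class is identified. -/
def stabilizerCon (s : M) : Con M where
  r a b := a * s = b * s ∨ (¬ a * s ∣ s ∧ ¬ b * s ∣ s)
  iseqv := by
    refine ⟨fun _ => Or.inl rfl, fun h => ?_, fun h k => ?_⟩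
    · exact h.imp Eq.symm And.symm
    · rcases h with h | h <;> rcases k with k | k
      · exact Or.inl (h.trans k)
      · exact Or.inr ⟨h ▸ k.1, k.2⟩
      · exact Or.inr ⟨h.1, k ▸ h.2⟩
      · exact Or.inr ⟨h.1, k.2⟩
  mul' := by
    have key : ∀ {a c : M}, a * c * s ∣ s → a * s ∣ s ∧ c * s ∣ s := fun {a c} h =>
      ⟨(mul_dvd_mul_right (dvd_mul_right a c) s).trans h,
        (mul_dvd_mul_right (dvd_mul_left c a) s).trans h⟩
    intro a b c d hab hcd
    rcases hab with hab | hab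
    · rcases hcd with hcd | hcd
      · left
        rw [mul_assoc, hcd, mul_left_comm, hab, mul_left_comm, mul_assoc]
      · exact Or.inr ⟨fun h => hcd.1 (key h).2, fun h => hcd.2 (key h).2⟩
    · exact Or.inr ⟨fun h => hab.1 (key h).1, fun h => hab.2 (key h).1⟩

theorem finite_dvdClass_of_periodic [Monoid.FG M] (s : M)
    (h : ∀ x : M, x * s ∣ s → ∃ m, 0 < m ∧ x ^ m * s = s) : (dvdClass s).Finite := by
  have hfin : Finite (stabilizerCon s).Quotient := by
    refine Con.finite_quotient_of_periodic _ fun x => ?_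
    by_cases hx : x * s ∣ s
    · obtain ⟨m, hm, hms⟩ := h x hx
      refine ⟨0, m, hm, Or.inl ?_⟩
      simpa using hms.symm
    · refine ⟨1, 1, one_pos, Or.inr ⟨by simpa using hx, fun h => hx ?_⟩⟩
      exact (mul_dvd_mul_right (dvd_pow_self x two_ne_zero) s).trans h
  have hex : ∀ h : dvdClass s, ∃ a, h.1 = a * s := fun h => by
    obtain ⟨a, ha⟩ := h.2.2
    exact ⟨a, ha.trans (mul_comm _ _)⟩
  choose a ha using hex
  refine Set.finite_coe_iff.1 (Finite.of_injective
    (fun h : dvdClass s => (a h : (stabilizerCon s).Quotient)) fun g h hgh => ?_)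
  rcases (Con.eq _).1 hgh with e | e
  · exact Subtype.ext (by rw [ha g, ha h, e])
  · exact (e.1 (ha g ▸ g.2.1)).elim

end CommMonoid

section WithOne

variable {S : Type*} [CommSemigroup S]

theorem WithOne.exists_coe_eq_coe_mul (a : S) (b : WithOne S) :
    ∃ c : S, (c : WithOne S) = a * b := by
  induction b using WithOne.recOneCoe with
  | one => exact ⟨a, (mul_one _).symm⟩
  | coe b => exact ⟨a * b, rfl⟩

theorem WithOne.coe_dvd_coe_iff {a b : S} :
    (a : WithOne S) ∣ b ↔ b = a ∨ ∃ c, b = a * c := by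
  constructor
  · rintro ⟨c, hc⟩
    induction c using WithOne.recOneCoe with
    | one => exact Or.inl (WithOne.coe_inj.1 (by simpa using hc))
    | coe c => exact Or.inr ⟨c, WithOne.coe_inj.1 hc⟩
  · rintro (rfl | ⟨c, rfl⟩)
    · exact dvd_rfl
    · exact ⟨c, rfl⟩

theorem greenH_iff_dvd {x y : S} :
    GreenH x y ↔ (y : WithOne S) ∣ x ∧ (x : WithOne S) ∣ y := by
  have hR : ∀ a : S, insert a {z : S | ∃ s : S, z = a * s} = {z : S | (a : WithOne S) ∣ z} :=
    fun a => by
      ext z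
      simp only [Set.mem_insert_iff, Set.mem_ofPred_eq, WithOne.coe_dvd_coe_iff]
  have hL : ∀ a : S, insert a {z : S | ∃ s : S, z = s * a} = {z : S | (a : WithOne S) ∣ z} :=
    fun a => by simp only [mul_comm _ a, hR]
  rw [GreenH, hR, hR, hL, hL, and_self, Set.ext_iff]
  constructor
  · intro h
    exact ⟨(h x).1 dvd_rfl, (h y).2 dvd_rfl⟩
  · rintro ⟨h, k⟩ z
    exact ⟨h.trans, k.trans⟩

theorem finite_hClass_iff (x : S) :
    (HClass x).Finite ↔ (dvdClass (x : WithOne S)).Finite := by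
  have himage : dvdClass (x : WithOne S) = (fun y : S => (y : WithOne S)) '' HClass x := by
    ext y
    constructor
    · rintro ⟨hy, c, rfl⟩
      obtain ⟨z, hz⟩ := WithOne.exists_coe_eq_coe_mul x c
      exact ⟨z, greenH_iff_dvd.2 ⟨hz ▸ hy, ⟨c, hz⟩⟩, hz⟩
    · rintro ⟨z, hz, rfl⟩
      exact greenH_iff_dvd.1 hz
  rw [himage, Set.finite_image_iff WithOne.coe_injective.injOn]

theorem WithOne.fg_of_closure_eq_top {Y : Finset S}
    (hY : Subsemigroup.closure (Y : Set S) = ⊤) : Monoid.FG (WithOne S) := by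
  classical
  refine ⟨⟨Y.image (fun y => (y : WithOne S)), top_unique fun a _ => ?_⟩⟩
  induction a using WithOne.recOneCoe with
  | one => exact one_mem _
  | coe a =>
    have ha : a ∈ Subsemigroup.closure (Y : Set S) := hY ▸ Subsemigroup.mem_top a
    induction ha using Subsemigroup.closure_induction with
    | mem y hy => exact Submonoid.subset_closure (by simpa using hy)
    | mul y z _ _ ihy ihz =>
      rw [WithOne.coe_mul]
      exact mul_mem (ihy trivial) (ihz trivial)

theorem isCompletelySeparable_of_finite_hClass [Monoid.FG (WithOne S)]
    (h : ∀ x : S, (HClass x).Finite) : IsCompletelySeparable S := by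
  intro s
  have := finite_quotient_syntacticCon (s : WithOne S) ((finite_hClass_iff s).1 (h s))
  refine ⟨Shrink.{0} (syntacticCon (s : WithOne S)).Quotient, inferInstance, inferInstance,
    (Shrink.mulEquiv.symm.toMulHom.comp (syntacticCon (s : WithOne S)).mk'.toMulHom).comp
      WithOne.coeMulHom, ?_⟩
  rintro ⟨t, hts, ht⟩
  have ht' := (Con.eq _).1 (Shrink.mulEquiv.symm.injective ht)
  exact hts (WithOne.coe_inj.1 (by simpa using (ht' 1).2 (mul_one _)))

theorem IsCompletelySeparable.isStronglySubsemigroupSeparable {S : Type*} [Semigroup S]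
    (h : IsCompletelySeparable S) : IsStronglySubsemigroupSeparable S := by
  intro T s hs
  obtain ⟨U, i, j, f, hf⟩ := h s
  refine ⟨U, i, j, f, fun hT => hf (Set.image_mono ?_ hT)⟩
  rintro t ht rfl
  exact hs ht

theorem IsStronglySubsemigroupSeparable.isWeaklySubsemigroupSeparable {S : Type*} [Semigroup S]
    (h : IsStronglySubsemigroupSeparable S) : IsWeaklySubsemigroupSeparable S :=
  fun T _ => h T

/-- If `x` acts invertibly on `t`, a finitely generated subsemigroup containing all
`xᵐ * t` with `m` positive contains `t`. -/
theorem IsWeaklySubsemigroupSeparable.mem_of_pow_mul_mem (hS : IsWeaklySubsemigroupSeparable S)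
    (Y : Finset S) {x : WithOne S} {t : S} (hx : x * t ∣ (t : WithOne S))
    (hT : ∀ m, ∃ z ∈ Subsemigroup.closure (Y : Set S), (z : WithOne S) = x ^ (m + 1) * t) :
    t ∈ Subsemigroup.closure (Y : Set S) := by
  by_contra ht
  obtain ⟨U, _, _, f, hf⟩ := hS _ ⟨Y, rfl⟩ t ht
  have : Finite (WithOne U) := inferInstanceAs (Finite (Option U))
  obtain ⟨m, hm, hmt⟩ := (WithOne.mapMulHom f).exists_map_pow_mul_eq hx (Set.toFinite _)
  obtain ⟨k, rfl⟩ := Nat.exists_eq_succ_of_ne_zero hm.ne'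
  obtain ⟨z, hz, hzk⟩ := hT k
  rw [Nat.succ_eq_add_one, ← hzk, WithOne.mapMulHom_coe, WithOne.mapMulHom_coe,
    WithOne.coe_inj] at hmt
  exact hf ⟨z, hz, hmt⟩

theorem IsWeaklySubsemigroupSeparable.exists_pow_mul_eq (hS : IsWeaklySubsemigroupSeparable S)
    (s : S) (x : WithOne S) (hx : x * s ∣ (s : WithOne S)) :
    ∃ m, 0 < m ∧ x ^ m * s = (s : WithOne S) := by
  classical
  induction x using WithOne.recOneCoe with
  | one => exact ⟨1, one_pos, by simp⟩
  | coe x =>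
  by_contra! hne
  by_cases hreg : (s : WithOne S) * s ∣ s
  · obtain ⟨w, hw⟩ := hreg
    obtain ⟨e, he⟩ := WithOne.exists_coe_eq_coe_mul s w
    have hse : (e : WithOne S) * s = s := by
      rw [he]; conv_rhs => rw [hw]
      ac_rfl
    have hee : (e : WithOne S) * e = e := by
      conv_lhs => rw [he]
      rw [he, ← mul_assoc, mul_right_comm _ w, ← hw]
    have hxe : (x : WithOne S) * e ∣ e := by
      rw [he, ← mul_assoc]; exact mul_dvd_mul_right hx w
    have hpow : ∀ i : ℕ, 0 < i → ((x : WithOne S) * e) ^ i = x ^ i * e := by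
      intro i hi
      rw [mul_pow]
      congr 1
      exact (show IsIdempotentElem (e : WithOne S) from hee).pow_eq hi.ne'
    have hmem : ∀ z ∈ Subsemigroup.closure (({x * e} : Finset S) : Set S),
        ∃ i, 0 < i ∧ (z : WithOne S) = (x * e) ^ i := by
      intro z hz
      induction hz using Subsemigroup.closure_induction with
      | mem y hy =>
        obtain rfl : y = x * e := by simpa using hy
        exact ⟨1, one_pos, by simp⟩
      | mul y z _ _ ihy ihz =>
        obtain ⟨i, hi, hy⟩ := ihy
        obtain ⟨j, hj, hz⟩ := ihz
        exact ⟨i + j, by omega, by rw [WithOne.coe_mul, hy, hz, pow_add]⟩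
    obtain ⟨i, hi, hei⟩ := hmem e <| hS.mem_of_pow_mul_mem {x * e} hxe fun m => by
      rw [← hpow _ m.succ_pos]
      induction m with
      | zero => exact ⟨x * e, Subsemigroup.subset_closure (by simp), by simp⟩
      | succ m ih =>
        obtain ⟨z, hz, hzm⟩ := ih
        refine ⟨z * (x * e), mul_mem hz (Subsemigroup.subset_closure (by simp)), ?_⟩
        rw [WithOne.coe_mul, hzm, pow_succ _ (m + 1), WithOne.coe_mul]
    refine hne i hi ?_
    rw [hpow i hi] at hei
    rw [← hse, ← mul_assoc, ← hei]
  · have hmem : ∀ z ∈ Subsemigroup.closure (({x, x * s} : Finset S) : Set S),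
        (∃ i, 0 < i ∧ (z : WithOne S) = x ^ i) ∨ (∃ i, 0 < i ∧ (z : WithOne S) = x ^ i * s) ∨
          (s : WithOne S) * s ∣ z := by
      intro z hz
      induction hz using Subsemigroup.closure_induction with
      | mem y hy =>
        have hy' : y = x ∨ y = x * s := by simpa using hy
        rcases hy' with rfl | rfl
        · exact Or.inl ⟨1, one_pos, by simp⟩
        · exact Or.inr (Or.inl ⟨1, one_pos, by simp⟩)
      | mul y z _ _ ihy ihz =>
        rw [WithOne.coe_mul]
        rcases ihy with ⟨i, hi, hy⟩ | ⟨i, hi, hy⟩ | hy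
        · rcases ihz with ⟨j, hj, hz⟩ | ⟨j, hj, hz⟩ | hz
          · exact Or.inl ⟨i + j, by omega, by rw [hy, hz, pow_add]⟩
          · exact Or.inr (Or.inl ⟨i + j, by omega, by rw [hy, hz, pow_add, mul_assoc]⟩)
          · exact Or.inr (Or.inr (hz.mul_left _))
        · rcases ihz with ⟨j, hj, hz⟩ | ⟨j, hj, hz⟩ | hz
          · exact Or.inr (Or.inl ⟨i + j, by omega, by rw [hy, hz, pow_add, mul_right_comm]⟩)
          · exact Or.inr (Or.inr (mul_dvd_mul ⟨x ^ i, by rw [hy, mul_comm]⟩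
              ⟨x ^ j, by rw [hz, mul_comm]⟩))
          · exact Or.inr (Or.inr (hz.mul_left _))
        · exact Or.inr (Or.inr (hy.mul_right _))
    rcases hmem s <| hS.mem_of_pow_mul_mem {x, x * s} hx fun m => by
      induction m with
      | zero => exact ⟨x * s, Subsemigroup.subset_closure (by simp), by simp⟩
      | succ m ih =>
        obtain ⟨z, hz, hzm⟩ := ih
        refine ⟨x * z, mul_mem (Subsemigroup.subset_closure (by simp)) hz, ?_⟩
        rw [WithOne.coe_mul, hzm, pow_succ' _ (m + 1), mul_assoc]
      with ⟨i, -, hi⟩ | ⟨i, hi, his⟩ | h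
    · obtain ⟨u, hu⟩ := hx
      have hu' : (s : WithOne S) = x * u * s := by rw [mul_right_comm]; exact hu
      refine hreg ⟨u ^ i, ?_⟩
      conv_rhs => rw [mul_assoc]; arg 1; rw [hi]
      rw [mul_comm (s : WithOne S)]
      exact eq_mul_pow_mul_of_eq_mul_mul hu' i
    · exact hne i hi his.symm
    · exact hreg h

end WithOne

theorem fg_comm_semigroup_separability_tfae (S : Type*) [CommSemigroup S]
    (hfg : ∃ Y : Finset S, Subsemigroup.closure (Y : Set S) = ⊤) :
    (IsCompletelySeparable S ↔ IsStronglySubsemigroupSeparable S) ∧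
    (IsStronglySubsemigroupSeparable S ↔ IsWeaklySubsemigroupSeparable S) ∧
    (IsWeaklySubsemigroupSeparable S ↔ ∀ x : S, (HClass x).Finite) := by
  obtain ⟨Y, hY⟩ := hfg
  have := WithOne.fg_of_closure_eq_top hY
  have hcs := IsCompletelySeparable.isStronglySubsemigroupSeparable (S := S)
  have hsw := IsStronglySubsemigroupSeparable.isWeaklySubsemigroupSeparable (S := S)
  have hwf : IsWeaklySubsemigroupSeparable S → ∀ x : S, (HClass x).Finite := fun h x =>
    (finite_hClass_iff x).2 (finite_dvdClass_of_periodic _ (h.exists_pow_mul_eq x))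
  have hfc := isCompletelySeparable_of_finite_hClass (S := S)
  exact ⟨⟨hcs, hfc ∘ hwf ∘ hsw⟩, ⟨hsw, hcs ∘ hfc ∘ hwf⟩, ⟨hwf, hsw ∘ hcs ∘ hfc⟩⟩
end

section
/- If a residually finite semigroup S has the additive semigroup ℕ of positive integers as a homomorphic image (i.e. there is a surjective homomorphism S → ℕ), then S is weakly subsemigroup separable. -/
open scoped Pointwise

/-- The natural numbers at most `n`, with addition truncated at `n`, written multiplicatively. -/
def TruncatedNat (n : ℕ) : Type := Fin (n + 1)

namespace TruncatedNat

/-- The truncation map from the natural numbers. -/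
def trunc (n k : ℕ) : TruncatedNat n := (⟨min k n, by omega⟩ : Fin (n + 1))

instance (n : ℕ) : Finite (TruncatedNat n) := inferInstanceAs (Finite (Fin (n + 1)))

instance (n : ℕ) : Semigroup (TruncatedNat n) where
  mul a b := trunc n (Fin.val a + Fin.val b)
  mul_assoc a b c := by
    apply Fin.ext
    change min (min (Fin.val a + Fin.val b) n + Fin.val c) n
      = min (Fin.val a + min (Fin.val b + Fin.val c) n) n
    omega

theorem trunc_add (n k l : ℕ) : trunc n (k + l) = trunc n k * trunc n l := by
  apply Fin.ext
  change min (k + l) n = min (min k n + min l n) n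
  omega

theorem trunc_succ_eq_iff {n k : ℕ} : trunc (n + 1) n = trunc (n + 1) k ↔ n = k := by
  refine ⟨fun h => ?_, fun h => by rw [h]⟩
  have h' : min n (n + 1) = min k (n + 1) := congrArg Fin.val h
  omega

end TruncatedNat

/-- An element of a semigroup generated by `Y` is in `Y` or is a product of two elements. -/
theorem Subsemigroup.mem_or_mem_mul_of_mem_closure {S : Type*} [Semigroup S] {Y : Set S} {t : S}
    (ht : t ∈ Subsemigroup.closure Y) :
    t ∈ Y ∨ ∃ a ∈ Subsemigroup.closure Y, ∃ b ∈ Subsemigroup.closure Y, a * b = t := by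
  induction ht using Subsemigroup.closure_induction with
  | mem x hx => exact Or.inl hx
  | mul x y hx hy _ _ => exact Or.inr ⟨x, hx, y, hy, rfl⟩

/-- A finitely generated semigroup graded by the positive integers has finitely many elements
of bounded degree. -/
theorem Subsemigroup.finite_closure_degree_le {S : Type*} [Semigroup S] {Y : Set S}
    (hY : Y.Finite) (f : S → ℕ+) (hf : ∀ a b : S, f (a * b) = f a + f b) (n : ℕ) :
    {t : S | t ∈ Subsemigroup.closure Y ∧ (f t : ℕ) ≤ n}.Finite := by
  induction n with
  | zero =>
    convert Set.finite_empty (α := S)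
    ext t
    have := (f t).pos
    simp
  | succ n ih =>
    refine (hY.union (ih.mul ih)).subset ?_
    rintro t ⟨ht, htn⟩
    rcases Subsemigroup.mem_or_mem_mul_of_mem_closure ht with h | ⟨a, ha, b, hb, rfl⟩
    · exact Or.inl h
    · have hpa := (f a).pos
      have hpb := (f b).pos
      rw [hf, PNat.add_coe] at htn
      exact Or.inr (Set.mul_mem_mul ⟨ha, by omega⟩ ⟨hb, by omega⟩)

/-- In a residually finite semigroup graded by the positive integers, an element can be separated
in a finite image from a finite set and all elements of different degree. -/
theorem IsResiduallyFiniteSemigroup.exists_separating {S : Type*} [Semigroup S]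
    (hrf : IsResiduallyFiniteSemigroup S)
    (f : S → ℕ+) (hf : ∀ a b : S, f (a * b) = f a + f b) (s : S) {F : Set S} (hF : F.Finite)
    (hs : s ∉ F) :
    ∃ (U : Type) (_ : Semigroup U) (_ : Finite U) (g : S →ₙ* U),
      ∀ t : S, t ∈ F ∨ f s ≠ f t → g s ≠ g t := by
  induction F, hF using Set.Finite.induction_on with
  | empty =>
    refine ⟨TruncatedNat (f s + 1), inferInstance, inferInstance,
      ⟨fun t => TruncatedNat.trunc _ (f t), fun a b => ?_⟩, fun t ht h => ?_⟩
    · rw [hf, PNat.add_coe, TruncatedNat.trunc_add]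
    · rcases ht with ht | ht
      · exact ht
      · exact ht (PNat.eq (TruncatedNat.trunc_succ_eq_iff.1 h))
  | @insert a F _ _ ih =>
    rw [Set.mem_insert_iff, not_or] at hs
    obtain ⟨U, _, _, g, hg⟩ := ih hs.2
    obtain ⟨V, _, _, h, hh⟩ := hrf s a hs.1
    refine ⟨U × V, inferInstance, inferInstance, g.prod h, fun t ht he => ?_⟩
    obtain ⟨he₁, he₂⟩ := Prod.ext_iff.1 he
    rcases ht with (rfl | ht) | ht
    · exact hh he₂
    · exact hg t (Or.inl ht) he₁
    · exact hg t (Or.inr ht) he₁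

theorem weakly_separable_of_nat_image (S : Type*) [Semigroup S]
    (hrf : IsResiduallyFiniteSemigroup S)
    (f : S → ℕ+) (hf : ∀ a b : S, f (a * b) = f a + f b) (hsurj : Function.Surjective f) :
    IsWeaklySubsemigroupSeparable S := by
  rintro T ⟨Y, rfl⟩ s hs
  obtain ⟨U, hU, hfin, g, hg⟩ := hrf.exists_separating f hf s
    (Subsemigroup.finite_closure_degree_le Y.finite_toSet f hf (f s)) (fun h => hs h.1)
  refine ⟨U, hU, hfin, g, ?_⟩
  rintro ⟨t, ht, hgt⟩
  refine hg t ?_ hgt.symm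
  by_cases h : f s = f t
  · exact Or.inl ⟨ht, by rw [h]⟩
  · exact Or.inr h
end

section
/- The direct product S = ℕ × ℤ, where ℕ is the additive semigroup of positive integers and ℤ is the additive group of integers, is weakly subsemigroup separable but not strongly subsemigroup separable. -/
open scoped Pointwise

/-- The congruence on `ℕ × ℤ` that truncates the first coordinate above `n` and reduces the
second one modulo `M`. -/
def truncModCon (n M : ℕ) : Con (Multiplicative (ℕ+ × ℤ)) where
  r x y := min (x.toAdd.1 : ℕ) (n + 1) = min (y.toAdd.1 : ℕ) (n + 1) ∧
    (x.toAdd.2 : ZMod M) = (y.toAdd.2 : ZMod M)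
  iseqv := ⟨fun _ => ⟨rfl, rfl⟩, fun h => ⟨h.1.symm, h.2.symm⟩,
    fun h k => ⟨h.1.trans k.1, h.2.trans k.2⟩⟩
  mul' := by
    rintro w x y z ⟨h₁, h₂⟩ ⟨k₁, k₂⟩
    refine ⟨?_, ?_⟩
    · simp only [toAdd_mul, Prod.fst_add, PNat.add_coe]
      omega
    · simp only [toAdd_mul, Prod.snd_add, Int.cast_add, h₂, k₂]

lemma truncModCon_iff {n M : ℕ} {x y : Multiplicative (ℕ+ × ℤ)} :
    truncModCon n M x y ↔ min (x.toAdd.1 : ℕ) (n + 1) = min (y.toAdd.1 : ℕ) (n + 1) ∧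
      (x.toAdd.2 : ZMod M) = (y.toAdd.2 : ZMod M) :=
  Iff.rfl

lemma finite_truncModCon_quotient (n M : ℕ) [NeZero M] : Finite (truncModCon n M).Quotient := by
  let g : (truncModCon n M).Quotient → Fin (n + 2) × ZMod M := fun q =>
    Con.liftOn q
      (fun x => (⟨min (x.toAdd.1 : ℕ) (n + 1), by omega⟩, (x.toAdd.2 : ZMod M)))
      (fun x y h => Prod.ext (Fin.ext h.1) h.2)
  refine Finite.of_injective g fun p q => ?_
  induction p using Con.induction_on with | _ x
  induction q using Con.induction_on with | _ y
  intro h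
  exact (Con.eq _).2
    (truncModCon_iff.2 ⟨congrArg (fun p => (p.1 : ℕ)) h, congrArg Prod.snd h⟩)

/-- In a finitely generated subsemigroup of `ℕ × ℤ` the second coordinate is bounded by a
multiple of the first. -/
lemma exists_abs_snd_le_of_mem_closure (Y : Finset (Multiplicative (ℕ+ × ℤ))) :
    ∃ B : ℕ, ∀ x ∈ Subsemigroup.closure (Y : Set (Multiplicative (ℕ+ × ℤ))),
      x.toAdd.2.natAbs ≤ B * (x.toAdd.1 : ℕ) := by
  refine ⟨Y.sup fun y => y.toAdd.2.natAbs, fun x hx => ?_⟩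
  induction hx using Subsemigroup.closure_induction with
  | mem x hx =>
    exact (Finset.le_sup (f := fun y : Multiplicative (ℕ+ × ℤ) => y.toAdd.2.natAbs) hx).trans
      (Nat.le_mul_of_pos_right _ x.toAdd.1.pos)
  | mul x y _ _ hx hy =>
    simp only [toAdd_mul, Prod.fst_add, Prod.snd_add, PNat.add_coe, mul_add]
    exact (Int.natAbs_add_le _ _).trans (add_le_add hx hy)

lemma isWeaklySubsemigroupSeparable_nat_times_int :
    IsWeaklySubsemigroupSeparable (Multiplicative (ℕ+ × ℤ)) := by
  rintro T ⟨Y, rfl⟩ s hs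
  obtain ⟨B, hB⟩ := exists_abs_snd_le_of_mem_closure Y
  set n : ℕ := (s.toAdd.1 : ℕ) with hn
  set M : ℕ := B * n + s.toAdd.2.natAbs + 1 with hM
  refine ⟨(truncModCon n M).Quotient, inferInstance, finite_truncModCon_quotient n M,
    ⟨fun x => (x : (truncModCon n M).Quotient), fun _ _ => rfl⟩, ?_⟩
  rintro ⟨t, ht, hts⟩
  obtain ⟨h₁, h₂⟩ := truncModCon_iff.1 ((Con.eq _).1 hts)
  have hfst : (t.toAdd.1 : ℕ) = n := by omega
  have hbound := hB t ht
  rw [hfst] at hbound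
  have hdvd : (M : ℤ) ∣ s.toAdd.2 - t.toAdd.2 :=
    (ZMod.intCast_eq_intCast_iff_dvd_sub _ _ _).1 h₂
  have hsnd : s.toAdd.2 - t.toAdd.2 = 0 :=
    Int.eq_zero_of_abs_lt_dvd hdvd (abs_lt.2 (by omega))
  have hts' : t = s :=
    Multiplicative.toAdd.injective (Prod.ext (PNat.eq hfst) (by omega))
  exact hs (hts' ▸ ht)

/-- The subsemigroup of `ℕ × ℤ` of all `(k, z)` with `k ≥ 2`, except for `(2, 0)`. -/
def puncturedIdeal : Subsemigroup (Multiplicative (ℕ+ × ℤ)) where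
  carrier := {x | 2 < (x.toAdd.1 : ℕ) ∨ ((x.toAdd.1 : ℕ) = 2 ∧ x.toAdd.2 ≠ 0)}
  mul_mem' := by
    intro x y hx hy
    simp only [Set.mem_ofPred_eq, toAdd_mul, Prod.fst_add, PNat.add_coe] at hx hy ⊢
    omega

lemma mem_puncturedIdeal {x : Multiplicative (ℕ+ × ℤ)} :
    x ∈ puncturedIdeal ↔
      2 < (x.toAdd.1 : ℕ) ∨ ((x.toAdd.1 : ℕ) = 2 ∧ x.toAdd.2 ≠ 0) :=
  Iff.rfl

lemma not_isStronglySubsemigroupSeparable_nat_times_int :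
    ¬ IsStronglySubsemigroupSeparable (Multiplicative (ℕ+ × ℤ)) := by
  intro h
  obtain ⟨U, _, _, f, hf⟩ := h puncturedIdeal (.ofAdd (2, 0)) (by simp [mem_puncturedIdeal])
  obtain ⟨a, b, hab, hfab⟩ :=
    Finite.exists_ne_map_eq_of_infinite fun z : ℤ => f (.ofAdd ((1 : ℕ+), z))
  refine hf ⟨.ofAdd (2, b - a), ?_, ?_⟩
  · exact mem_puncturedIdeal.2 (.inr ⟨rfl, sub_ne_zero.2 hab.symm⟩)
  · have key (z : ℤ) : f (.ofAdd ((2 : ℕ+), z - a)) =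
        f (.ofAdd ((1 : ℕ+), -a)) * f (.ofAdd ((1 : ℕ+), z)) := by
      rw [← map_mul, ← ofAdd_add, Prod.mk_add_mk, neg_add_eq_sub]
      rfl
    rw [key, ← hfab, ← key, sub_self]

theorem nat_times_int_weak_not_strong :
    IsWeaklySubsemigroupSeparable (Multiplicative (ℕ+ × ℤ)) ∧
    ¬ IsStronglySubsemigroupSeparable (Multiplicative (ℕ+ × ℤ)) :=
  ⟨isWeaklySubsemigroupSeparable_nat_times_int,
    not_isStronglySubsemigroupSeparable_nat_times_int⟩
end

section
/- Let S be a semigroup with only finitely many H-classes whose maximal subgroups are all solvable. Then S is weakly subsemigroup separable if and only if all of its Schützenberger groups, viewed as semigroups, are weakly subsemigroup separable. -/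
open scoped Pointwise

universe u
/-- A function whose fibres are coarser than those of a function with finite range has finite
range. -/
theorem Set.Finite.range_of_factorsThrough {α β γ : Type*} {f : α → β} {g : α → γ}
    (hf : (Set.range f).Finite) (h : g.FactorsThrough f) : (Set.range g).Finite := by
  refine (hf.image fun b => {c | ∃ a, f a = b ∧ g a = c}).preimage
    (f := fun c : γ => ({c} : Set γ)) (fun _ _ _ _ h => Set.singleton_injective h) |>.subset ?_
  rintro _ ⟨a, rfl⟩
  refine ⟨f a, ⟨a, rfl⟩, ?_⟩
  ext c
  constructor
  · rintro ⟨b, hb, rfl⟩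
    exact h hb
  · rintro rfl
    exact ⟨a, rfl, rfl⟩

section Separability

variable {S : Type*} [Semigroup S]

/-- A finite semigroup image in any universe can be replaced by one in `Type`. -/
theorem MulHom.exists_type_zero {V : Type*} [Semigroup V] [Finite V] (f : S →ₙ* V) :
    ∃ (U : Type) (_ : Semigroup U) (_ : Finite U) (g : S →ₙ* U),
      ∀ x y, g x = g y → f x = f y :=
  ⟨Shrink.{0} V, inferInstance, inferInstance,
    (Shrink.mulEquiv.{0} (α := V)).symm.toMulHom.comp f,
    fun _ _ h => (Shrink.mulEquiv.{0} (α := V)).symm.injective h⟩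

theorem IsResiduallyFiniteSemigroup.exists_notMem_image (hS : IsResiduallyFiniteSemigroup S)
    {A : Set S} (hA : A.Finite) {s : S} (hs : s ∉ A) :
    ∃ (U : Type) (_ : Semigroup U) (_ : Finite U) (f : S →ₙ* U), f s ∉ f '' A := by
  induction A, hA using Set.Finite.induction_on with
  | empty => exact ⟨PUnit, inferInstance, inferInstance, ⟨fun _ => 1, fun _ _ => rfl⟩, by simp⟩
  | @insert a A _ _ ih =>
    rw [Set.mem_insert_iff, not_or] at hs
    obtain ⟨U, _, _, f, hf⟩ := ih hs.2
    obtain ⟨V, _, _, g, hg⟩ := hS s a hs.1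
    refine ⟨U × V, inferInstance, inferInstance, f.prod g, ?_⟩
    rintro ⟨b, rfl | hb, h⟩
    · exact hg (congrArg Prod.snd h).symm
    · exact hf ⟨b, hb, congrArg Prod.fst h⟩

theorem IsResiduallyFiniteSemigroup.isWeaklySubsemigroupSeparable
    (hS : IsResiduallyFiniteSemigroup S) (hlf : IsLocallyFiniteSemigroup S) :
    IsWeaklySubsemigroupSeparable S := by
  rintro _ ⟨Y, rfl⟩ s hs
  exact hS.exists_notMem_image (hlf Y) hs

theorem IsWeaklySubsemigroupSeparable.of_injective {G : Type*} [Semigroup G]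
    (hS : IsWeaklySubsemigroupSeparable S) (i : G →ₙ* S) (hi : Function.Injective i) :
    IsWeaklySubsemigroupSeparable G := by
  classical
  rintro _ ⟨Y, rfl⟩ g hg
  obtain ⟨U, _, _, f, hf⟩ := hS ((Subsemigroup.closure (Y : Set G)).map i)
    ⟨Y.image i, by rw [MulHom.map_mclosure, Finset.coe_image]⟩ (i g) (by
      rintro ⟨a, ha, h⟩
      exact hg (hi h ▸ ha))
  refine ⟨U, inferInstance, inferInstance, f.comp i, ?_⟩
  rintro ⟨a, ha, h⟩
  exact hf ⟨i a, ⟨a, ha, rfl⟩, h⟩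

theorem IsWeaklySubsemigroupSeparable.isMulTorsion {G : Type*} [Group G]
    (hG : IsWeaklySubsemigroupSeparable G) : IsMulTorsion G := by
  intro g
  rw [isOfFinOrder_iff_pow_eq_one]
  by_contra! hg
  have hpow : ∀ n : ℕ, 0 < n → g ^ n ∈ Subsemigroup.closure ({g} : Set G) := by
    intro n hn
    induction n, hn using Nat.le_induction with
    | base => simpa using Subsemigroup.subset_closure (Set.mem_singleton g)
    | succ n _ ih =>
      rw [pow_succ]
      exact mul_mem ih (Subsemigroup.subset_closure (Set.mem_singleton g))
  have key : ∀ x ∈ Subsemigroup.closure ({g} : Set G), ∃ n : ℕ, 0 < n ∧ g ^ n = x := by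
    intro x hx
    induction hx using Subsemigroup.closure_induction with
    | mem x hx => exact ⟨1, one_pos, by rw [pow_one, Set.mem_singleton_iff.1 hx]⟩
    | mul x y _ _ hx hy =>
      obtain ⟨m, hm, rfl⟩ := hx
      obtain ⟨n, _, rfl⟩ := hy
      exact ⟨m + n, by omega, pow_add g m n⟩
  have hone : (1 : G) ∉ Subsemigroup.closure ({g} : Set G) := by
    intro h
    obtain ⟨n, hn, h⟩ := key 1 h
    exact hg n hn h
  obtain ⟨U, _, _, f, hf⟩ := hG (Subsemigroup.closure {g}) ⟨{g}, by simp⟩ 1 hone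
  obtain ⟨i, j, hij, h⟩ := Finite.exists_ne_map_eq_of_infinite fun n : ℕ => f (g ^ n)
  wlog hlt : i < j generalizing i j
  · exact this j i hij.symm h.symm (by omega)
  refine hf ⟨g ^ (j - i), hpow _ (by omega), ?_⟩
  calc f (g ^ (j - i)) = f ((g ^ i)⁻¹ * g ^ j) := by
        congr 1
        rw [eq_inv_mul_iff_mul_eq, ← pow_add, Nat.add_sub_cancel' hlt.le]
    _ = f ((g ^ i)⁻¹ * g ^ i) := by rw [map_mul, map_mul]; exact congrArg _ h.symm
    _ = f 1 := by rw [inv_mul_cancel]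

theorem Subsemigroup.eq_or_eq_mul_of_mem_closure_singleton {s x : S}
    (hx : x ∈ closure {s}) : x = s ∨ ∃ k ∈ closure {s}, x = s * k := by
  induction hx using closure_induction with
  | mem x hx => exact Or.inl hx
  | mul x y _ hy hx _ =>
    rcases hx with rfl | ⟨k, hk, rfl⟩
    · exact Or.inr ⟨y, hy, rfl⟩
    · exact Or.inr ⟨k * y, mul_mem hk hy, mul_assoc _ _ _⟩

theorem Subsemigroup.commute_of_mem_closure_singleton {s x : S} (hx : x ∈ closure {s}) :
    Commute s x := by
  induction hx using closure_induction with
  | mem x hx => rw [Set.mem_singleton_iff.1 hx]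
  | mul x y _ _ hx hy => exact hx.mul_right hy

theorem IsWeaklySubsemigroupSeparable.isResiduallyFiniteSemigroup
    (hS : IsWeaklySubsemigroupSeparable S) : IsResiduallyFiniteSemigroup S := by
  intro s t hst
  by_contra! hsep
  have mem_of : ∀ x y : S, (∀ (U : Type) (_ : Semigroup U) (_ : Finite U) (f : S →ₙ* U),
      f x = f y) → x ∈ Subsemigroup.closure {y} := by
    intro x y h
    by_contra hx
    obtain ⟨U, _, _, f, hf⟩ := hS (Subsemigroup.closure {y}) ⟨{y}, by simp⟩ x hx
    exact hf ⟨y, Subsemigroup.subset_closure rfl, (h U _ ‹_› f).symm⟩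
  have hs := mem_of s t hsep
  have ht := mem_of t s fun U _ _ f => (hsep U _ ‹_› f).symm
  have hle : Subsemigroup.closure {t} ≤ Subsemigroup.closure {s} :=
    Subsemigroup.closure_le.2 (by simpa using ht)
  obtain ⟨a, ha, rfl⟩ :=
    (Subsemigroup.eq_or_eq_mul_of_mem_closure_singleton ht).resolve_left hst.symm
  obtain ⟨b, hb, hsb⟩ :=
    (Subsemigroup.eq_or_eq_mul_of_mem_closure_singleton hs).resolve_left hst
  have hmem := mul_mem ha (hle hb)
  have hse : s * (a * b) = s := by rw [← mul_assoc, ← hsb]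
  have hes : a * b * s = s := by
    rw [← (Subsemigroup.commute_of_mem_closure_singleton hmem).eq, hse]
  have hleft : ∀ x ∈ Subsemigroup.closure {s}, a * b * x = x := by
    intro x hx
    rcases Subsemigroup.eq_or_eq_mul_of_mem_closure_singleton hx with rfl | ⟨k, _, rfl⟩
    · exact hes
    · rw [← mul_assoc, hes]
  have hae : a ∈ Subsemigroup.closure {a * b} := by
    refine mem_of _ _ fun U _ _ f => ?_
    have hf := hsep U _ ‹_› f
    have h : f (a * b) = f (a * b * a) := by
      rcases Subsemigroup.eq_or_eq_mul_of_mem_closure_singleton hmem with h | ⟨k, hk, h⟩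
      · rw [h]
        exact hf
      · rw [h, (Subsemigroup.commute_of_mem_closure_singleton hk).eq, mul_assoc, map_mul, hf,
          ← map_mul]
    rw [h, hleft a ha]
  have key : ∀ x ∈ Subsemigroup.closure {a * b}, x = a * b := by
    intro x hx
    induction hx using Subsemigroup.closure_induction with
    | mem x hx => exact hx
    | mul x y _ _ hx hy => rw [hx, hy, hleft _ hmem]
  apply hst
  rw [key a hae, hse]

end Separability

theorem Subgroup.finiteIndex_derivedSeries_of_fg_of_isMulTorsion {G : Type*} [Group G]
    [Group.FG G] (hG : IsMulTorsion G) (n : ℕ) : (derivedSeries G n).FiniteIndex := by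
  induction n with
  | zero => rw [derivedSeries_zero]; infer_instance
  | succ n ih =>
    have : Group.FG (Abelianization (derivedSeries G n)) :=
      Group.fg_of_surjective (f := Abelianization.of) (QuotientGroup.mk'_surjective _)
    have hfin : Finite (derivedSeries G n ⧸ _root_.commutator (derivedSeries G n)) :=
      CommGroup.finite_of_fg_isMulTorsion (Abelianization (derivedSeries G n))
        ((hG.subgroup _).of_surjective (f := Abelianization.of) (QuotientGroup.mk'_surjective _))
    have hc : (_root_.commutator (derivedSeries G n)).FiniteIndex :=
      Subgroup.finiteIndex_of_finite_quotient
    rw [derivedSeries_succ, ← Subgroup.map_subtype_commutator]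
    refine ⟨?_⟩
    rw [Subgroup.index_map_subtype]
    exact mul_ne_zero hc.index_ne_zero ih.index_ne_zero

theorem Group.finite_of_fg_of_isMulTorsion_of_isSolvable {G : Type*} [Group G] [Group.FG G]
    [Group.IsSolvable G] (hG : IsMulTorsion G) : Finite G := by
  obtain ⟨n, hn⟩ := Group.IsSolvable.solvable (G := G)
  have := Subgroup.finiteIndex_derivedSeries_of_fg_of_isMulTorsion hG n
  rw [hn] at this
  exact Subgroup.finite_iff_finite_and_finiteIndex (H := ⊥) |>.2 ⟨inferInstance, this⟩

theorem IsMulTorsion.isLocallyFiniteSemigroup {G : Type*} [Group G] [Group.IsSolvable G]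
    (hG : IsMulTorsion G) : IsLocallyFiniteSemigroup G := by
  intro Y
  have : Group.FG (Subgroup.closure (Y : Set G)) := Group.closure_finset_fg Y
  have hfin : Finite (Subgroup.closure (Y : Set G)) :=
    Group.finite_of_fg_of_isMulTorsion_of_isSolvable (hG.subgroup _)
  refine (Set.toFinite (Subgroup.closure (Y : Set G) : Set G)).subset ?_
  exact Subsemigroup.closure_le (S := (Subgroup.closure (Y : Set G)).toSubmonoid.toSubsemigroup)
    |>.2 Subgroup.subset_closure

/-- Local finiteness passes from a semigroup to another one that is covered by a submonoid
on which it is coarser. -/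
theorem IsLocallyFiniteSemigroup.of_factorsThrough {B G K : Type*} [Semigroup B] [Semigroup G]
    [Semigroup K] (hG : IsLocallyFiniteSemigroup G) (f : B →ₙ* G) (g : B →ₙ* K)
    (hg : Function.Surjective g) (h : Function.FactorsThrough g f) :
    IsLocallyFiniteSemigroup K := by
  classical
  intro Y
  obtain ⟨Z, rfl⟩ : ∃ Z : Finset B, Z.image g = Y :=
    ⟨Y.image (Function.surjInv hg), by
      ext y; simp [Function.surjInv_eq]⟩
  have hfin := hG (Z.image f)
  rw [Finset.coe_image, ← MulHom.map_mclosure] at hfin ⊢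
  rw [Subsemigroup.coe_map, Set.image_eq_range] at hfin ⊢
  exact hfin.range_of_factorsThrough fun _ _ hab => h hab

/-- A function on a monoid with finite range whose kernel is a right congruence factors through a
finite semigroup image. -/
theorem exists_mulHom_of_rightInvariant {M A : Type*} [Monoid M] {F : M → A}
    (hfin : (Set.range F).Finite) (hF : ∀ x y u, F x = F y → F (x * u) = F (y * u)) :
    ∃ (U : Type) (_ : Semigroup U) (_ : Finite U) (f : M →ₙ* U), ∀ x y, f x = f y → F x = F y := by
  have : Finite (Set.range F) := hfin
  choose r hr using fun a : Set.range F => a.2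
  have : Finite (Function.End (Set.range F)) := inferInstanceAs (Finite (_ → _))
  have : Finite (Function.End (Set.range F))ᵐᵒᵖ := Finite.of_equiv _ MulOpposite.opEquiv
  let f : M →ₙ* (Function.End (Set.range F))ᵐᵒᵖ :=
    { toFun x := MulOpposite.op fun a => ⟨F (r a * x), Set.mem_range_self _⟩
      map_mul' x y := by
        refine congrArg MulOpposite.op (funext fun a => Subtype.ext ?_)
        change F (r a * (x * y)) = F (r ⟨F (r a * x), _⟩ * y)
        rw [← mul_assoc]
        exact hF _ _ _ (hr ⟨F (r a * x), Set.mem_range_self _⟩).symm }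
  obtain ⟨U, hU, hU', g, hg⟩ := f.exists_type_zero
  refine ⟨U, hU, hU', g, fun x y h => ?_⟩
  have h1 := congrArg Subtype.val (congrFun (congrArg MulOpposite.unop (hg x y h))
    ⟨F 1, Set.mem_range_self 1⟩)
  have h2 : ∀ z, F (r ⟨F 1, Set.mem_range_self 1⟩ * z) = F z := fun z => by
    rw [hF _ 1 z (hr _), one_mul]
  exact (h2 x).symm.trans (h1.trans (h2 y))

namespace GreenRelation

variable {M : Type*} [Monoid M]

/-- The principal right ideal generated by an element. -/
def rightIdeal (x : M) : Set M := {z | ∃ u, z = x * u}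

/-- The principal left ideal generated by an element. -/
def leftIdeal (x : M) : Set M := {z | ∃ u, z = u * x}

/-- The pair of principal one-sided ideals of an element, which determines its `H`-class. -/
def idealPair (x : M) : Set M × Set M := (rightIdeal x, leftIdeal x)

variable {x y z h s t : M}

theorem rightIdeal_subset_iff : rightIdeal x ⊆ rightIdeal y ↔ ∃ u, x = y * u := by
  refine ⟨fun hxy => hxy ⟨1, (mul_one x).symm⟩, ?_⟩
  rintro ⟨u, rfl⟩ _ ⟨v, rfl⟩
  exact ⟨u * v, mul_assoc _ _ _⟩

theorem leftIdeal_subset_iff : leftIdeal x ⊆ leftIdeal y ↔ ∃ u, x = u * y := by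
  refine ⟨fun hxy => hxy ⟨1, (one_mul x).symm⟩, ?_⟩
  rintro ⟨u, rfl⟩ _ ⟨v, rfl⟩
  exact ⟨v * u, (mul_assoc _ _ _).symm⟩

theorem rightIdeal_mul_subset (x u : M) : rightIdeal (x * u) ⊆ rightIdeal x :=
  rightIdeal_subset_iff.2 ⟨u, rfl⟩

theorem leftIdeal_mul_subset (u x : M) : leftIdeal (u * x) ⊆ leftIdeal x :=
  leftIdeal_subset_iff.2 ⟨u, rfl⟩

theorem rightIdeal_eq_iff :
    rightIdeal x = rightIdeal y ↔ (∃ u, x = y * u) ∧ ∃ u, y = x * u := by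
  rw [Set.Subset.antisymm_iff, rightIdeal_subset_iff, rightIdeal_subset_iff]

theorem leftIdeal_eq_iff :
    leftIdeal x = leftIdeal y ↔ (∃ u, x = u * y) ∧ ∃ u, y = u * x := by
  rw [Set.Subset.antisymm_iff, leftIdeal_subset_iff, leftIdeal_subset_iff]

theorem idealPair_eq_iff :
    idealPair x = idealPair y ↔ rightIdeal x = rightIdeal y ∧ leftIdeal x = leftIdeal y :=
  Prod.mk_inj

theorem rightIdeal_mul_left (hxy : rightIdeal x = rightIdeal y) (g : M) :
    rightIdeal (g * x) = rightIdeal (g * y) := by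
  obtain ⟨⟨u, hu⟩, v, hv⟩ := rightIdeal_eq_iff.1 hxy
  exact rightIdeal_eq_iff.2 ⟨⟨u, by rw [mul_assoc, ← hu]⟩, v, by rw [mul_assoc, ← hv]⟩

theorem leftIdeal_mul_right (hxy : leftIdeal x = leftIdeal y) (g : M) :
    leftIdeal (x * g) = leftIdeal (y * g) := by
  obtain ⟨⟨u, hu⟩, v, hv⟩ := leftIdeal_eq_iff.1 hxy
  exact leftIdeal_eq_iff.2 ⟨⟨u, by rw [← mul_assoc, ← hu]⟩, v, by rw [← mul_assoc, ← hv]⟩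

/-- Green's lemma: right translations between the `H`-classes inside an `R`-class. -/
theorem exists_translations (i : Set M × Set M) (h : M) :
    ∃ c d : M, ∀ x, idealPair x = i → rightIdeal x = rightIdeal h →
      idealPair (x * c) = idealPair h ∧ x * c * d = x := by
  by_cases hz : ∃ z, idealPair z = i ∧ rightIdeal z = rightIdeal h
  · obtain ⟨z, rfl, hz⟩ := hz
    obtain ⟨⟨d, hd⟩, c, hc⟩ := rightIdeal_eq_iff.1 hz
    refine ⟨c, d, fun x hx hxh => ?_⟩
    obtain ⟨g, hg⟩ := (leftIdeal_eq_iff.1 (idealPair_eq_iff.1 hx).2).1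
    have hxcd : x * c * d = x := by rw [hg, mul_assoc g, ← hc, mul_assoc, ← hd]
    refine ⟨idealPair_eq_iff.2 ⟨?_, ?_⟩, hxcd⟩
    · rw [← hxh]
      exact rightIdeal_eq_iff.2 ⟨⟨c, rfl⟩, d, hxcd.symm⟩
    · rw [leftIdeal_mul_right (idealPair_eq_iff.1 hx).2 c, ← hc]
  · exact ⟨1, 1, fun x hx hxh => (hz ⟨x, hx, hxh⟩).elim⟩

theorem idealPair_mul_of_idealPair_eq (hxh : idealPair x = idealPair h)
    (hs : idealPair (h * s) = idealPair h) : idealPair (x * s) = idealPair h := by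
  obtain ⟨hr, hl⟩ := idealPair_eq_iff.1 hxh
  obtain ⟨hsr, hsl⟩ := idealPair_eq_iff.1 hs
  obtain ⟨g, hg⟩ := (leftIdeal_eq_iff.1 hl).1
  refine idealPair_eq_iff.2 ⟨?_, (leftIdeal_mul_right hl s).trans hsl⟩
  rw [hg, mul_assoc, rightIdeal_mul_left hsr g, ← hg, hr]

/-- The right stabiliser of the `H`-class of an element. -/
def stab (h : M) : Submonoid M where
  carrier := {s | idealPair (h * s) = idealPair h}
  one_mem' := by rw [Set.mem_ofPred_eq, mul_one]
  mul_mem' {s t} hs ht := by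
    rw [Set.mem_ofPred_eq, ← mul_assoc]
    exact idealPair_mul_of_idealPair_eq hs ht

theorem mem_stab : s ∈ stab h ↔ idealPair (h * s) = idealPair h := Iff.rfl

theorem mem_stab_iff_of_idealPair_eq (hxh : idealPair x = idealPair h) :
    s ∈ stab h ↔ idealPair (x * s) = idealPair h := by
  refine ⟨idealPair_mul_of_idealPair_eq hxh, fun hs => ?_⟩
  rw [← hxh] at hs
  rw [mem_stab, ← hxh]
  exact idealPair_mul_of_idealPair_eq hxh.symm hs

/-- Elements of the stabiliser agreeing at one element of the `H`-class agree on the whole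
class. -/
theorem mul_eq_mul_of_idealPair_eq (hxh : idealPair x = idealPair h) (hst : h * s = h * t) :
    x * s = x * t := by
  obtain ⟨g, hg⟩ := (leftIdeal_eq_iff.1 (idealPair_eq_iff.1 hxh).2).1
  rw [hg, mul_assoc, hst, mul_assoc]

/-- A group quotient of the stabiliser of `h` that realises the Schützenberger group of the
`H`-class of `h`. -/
def IsSchutzenbergerQuotient (h : M) {Γ : Type*} [Group Γ] (φ : stab h →* Γ) : Prop :=
  Function.Surjective φ ∧ ∀ a b : stab h, φ a = φ b ↔ h * (a : M) = h * (b : M)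

theorem exists_mul_mul_eq (hs : s ∈ stab h) :
    ∃ v ∈ stab h, h * (s * v) = h ∧ h * (v * s) = h := by
  obtain ⟨v, hv⟩ := (rightIdeal_eq_iff.1 (idealPair_eq_iff.1 hs).1).2
  refine ⟨v, ?_, by rw [← mul_assoc, ← hv], ?_⟩
  · rw [mem_stab_iff_of_idealPair_eq hs, ← hv]
  · have := mul_eq_mul_of_idealPair_eq (s := v * s) (t := 1) (h := h * s) (x := h)
      hs.symm (by rw [← mul_assoc, ← hv, mul_one])
    rw [this, mul_one]

theorem exists_isSchutzenbergerQuotient {M : Type u} [Monoid M] (h : M) :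
    ∃ (Γ : Type u) (_ : Group Γ) (φ : stab h →* Γ), IsSchutzenbergerQuotient h φ := by
  let c : Con (stab h) :=
    { r a b := h * (a : M) = h * (b : M)
      iseqv := ⟨fun _ => rfl, Eq.symm, Eq.trans⟩
      mul' {a b a' b'} hab hab' := by
        change h * (a * a' : M) = h * (b * b' : M)
        rw [← mul_assoc, ← mul_assoc, hab]
        exact mul_eq_mul_of_idealPair_eq b.2 hab' }
  have hunit : ∀ a : c.Quotient, IsUnit a := by
    intro a
    obtain ⟨⟨s, hs⟩, rfl⟩ := c.mk'_surjective a
    obtain ⟨v, hv, h1, h2⟩ := exists_mul_mul_eq hs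
    exact ⟨⟨c.mk' ⟨s, hs⟩, c.mk' ⟨v, hv⟩, c.eq.2 (h1.trans (mul_one h).symm),
      c.eq.2 (h2.trans (mul_one h).symm)⟩, rfl⟩
  exact ⟨c.Quotient, groupOfIsUnit hunit, c.mk', c.mk'_surjective, fun a b => c.eq⟩

theorem wellFounded_rightIdeal_ssubset (hfin : (Set.range (rightIdeal (M := M))).Finite) :
    WellFounded fun x y : M => rightIdeal x ⊂ rightIdeal y := by
  have : Finite (Set.range (rightIdeal (M := M))) := hfin
  exact InvImage.wf (fun x : M => (⟨rightIdeal x, x, rfl⟩ : Set.range (rightIdeal (M := M))))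
    (wellFounded_lt (α := Set.range (rightIdeal (M := M))))

theorem wellFounded_leftIdeal_ssubset (hfin : (Set.range (leftIdeal (M := M))).Finite) :
    WellFounded fun x y : M => leftIdeal x ⊂ leftIdeal y := by
  have : Finite (Set.range (leftIdeal (M := M))) := hfin
  exact InvImage.wf (fun x : M => (⟨leftIdeal x, x, rfl⟩ : Set.range (leftIdeal (M := M))))
    (wellFounded_lt (α := Set.range (leftIdeal (M := M))))

theorem finite_range_rightIdeal (hfin : (Set.range (idealPair (M := M))).Finite) :
    (Set.range (rightIdeal (M := M))).Finite :=
  hfin.range_of_factorsThrough fun _ _ hxy => congrArg Prod.fst hxy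

theorem finite_range_leftIdeal (hfin : (Set.range (idealPair (M := M))).Finite) :
    (Set.range (leftIdeal (M := M))).Finite :=
  hfin.range_of_factorsThrough fun _ _ hxy => congrArg Prod.snd hxy

theorem exists_isIdempotentElem_idealPair_eq {p : M} (hp : idealPair (p * p) = idealPair p) :
    ∃ e : M, e * e = e ∧ idealPair e = idealPair p ∧ e * p = p ∧ p * e = p := by
  obtain ⟨hr, hl⟩ := idealPair_eq_iff.1 hp
  obtain ⟨a, ha⟩ := (rightIdeal_eq_iff.1 hr).2
  obtain ⟨b, hb⟩ := (leftIdeal_eq_iff.1 hl).2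
  have hab : p * a = b * p := by
    calc p * a = b * (p * p) * a := by rw [← hb]
      _ = b * (p * p * a) := mul_assoc _ _ _
      _ = b * p := by rw [← ha]
  have h1 : p * a * p = p := by rw [hab, mul_assoc, ← hb]
  have h2 : p * (p * a) = p := by rw [← mul_assoc, ← ha]
  refine ⟨p * a, by rw [← mul_assoc, h1], ?_, h1, h2⟩
  refine idealPair_eq_iff.2 ⟨rightIdeal_eq_iff.2 ⟨⟨a, rfl⟩, p, h1.symm⟩,
    leftIdeal_eq_iff.2 ⟨⟨b, hab⟩, p, h2.symm⟩⟩

/-- The stabiliser of an `H`-class contains an idempotent `e` whose `H`-class absorbs the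
stabiliser under `t ↦ e * t * e`. -/
theorem exists_isIdempotentElem_stab (hfin : (Set.range (idealPair (M := M))).Finite) (h : M) :
    ∃ e ∈ stab h, e * e = e ∧ h * e = h ∧ ∀ t ∈ stab h, idealPair (e * t * e) = idealPair e := by
  obtain ⟨s, hs, hsmin⟩ := (wellFounded_rightIdeal_ssubset (finite_range_rightIdeal hfin)).has_min
    (stab h : Set M) ⟨1, one_mem _⟩
  obtain ⟨l, hl, hlmin⟩ := (wellFounded_leftIdeal_ssubset (finite_range_leftIdeal hfin)).has_min
    (stab h : Set M) ⟨1, one_mem _⟩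
  have hr : ∀ t ∈ stab h, rightIdeal t ⊆ rightIdeal s → rightIdeal t = rightIdeal s :=
    fun t ht hts => hts.antisymm (by_contra fun hn => hsmin t ht ⟨hts, hn⟩)
  have hl' : ∀ t ∈ stab h, leftIdeal t ⊆ leftIdeal l → leftIdeal t = leftIdeal l :=
    fun t ht htl => htl.antisymm (by_contra fun hn => hlmin t ht ⟨htl, hn⟩)
  have hp : s * l ∈ stab h := mul_mem hs hl
  have hpr : rightIdeal (s * l) = rightIdeal s := hr _ hp (rightIdeal_mul_subset _ _)
  have hpl : leftIdeal (s * l) = leftIdeal l := hl' _ hp (leftIdeal_mul_subset _ _)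
  obtain ⟨e, hee, hep, hp1, hp2⟩ :=
    exists_isIdempotentElem_idealPair_eq (p := s * l) (idealPair_eq_iff.2
      ⟨(hr _ (mul_mem hp hp) ((rightIdeal_mul_subset _ _).trans hpr.subset)).trans hpr.symm,
        (hl' _ (mul_mem hp hp) ((leftIdeal_mul_subset _ _).trans hpl.subset)).trans hpl.symm⟩)
  obtain ⟨her, hel⟩ := idealPair_eq_iff.1 hep
  have hhe : h * e = h := by
    obtain ⟨g, hg⟩ := (leftIdeal_eq_iff.1 (idealPair_eq_iff.1 (mem_stab.1 hp)).2).2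
    calc h * e = g * (h * (s * l)) * e := by rw [← hg]
      _ = g * (h * (s * l * e)) := by simp only [mul_assoc]
      _ = h := by rw [hp2, ← hg]
  have he : e ∈ stab h := by rw [mem_stab, hhe]
  refine ⟨e, he, hee, hhe, fun t ht => ?_⟩
  have hete : e * t * e ∈ stab h := mul_mem (mul_mem he ht) he
  refine idealPair_eq_iff.2 ⟨?_, ?_⟩
  · rw [hr _ hete (by
      rw [mul_assoc]
      exact (rightIdeal_mul_subset _ _).trans (her.trans hpr).subset), her, hpr]
  · rw [hl' _ hete ((leftIdeal_mul_subset _ _).trans (hel.trans hpl).subset), hel, hpl]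

/-- If all maximal subgroups are locally finite then so are all Schützenberger groups. -/
theorem isLocallyFiniteSemigroup_of_idempotents
    (hfin : (Set.range (idealPair (M := M))).Finite)
    (hlf : ∀ e : M, e * e = e → ∃ (Γ : Type u) (_ : Group Γ) (φ : stab e →* Γ),
      IsSchutzenbergerQuotient e φ ∧ IsLocallyFiniteSemigroup Γ)
    (h : M) {Γ : Type*} [Group Γ] {φ : stab h →* Γ} (hφ : IsSchutzenbergerQuotient h φ) :
    IsLocallyFiniteSemigroup Γ := by
  obtain ⟨e, he, hee, hhe, habs⟩ := exists_isIdempotentElem_stab hfin h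
  obtain ⟨G, _, ψ, hψ, hG⟩ := hlf e hee
  let B : Submonoid M := stab h ⊓ stab e
  refine hG.of_factorsThrough (B := B)
    (ψ.comp (Submonoid.inclusion inf_le_right) : B →* G)
    (φ.comp (Submonoid.inclusion inf_le_left) : B →* Γ) ?_ ?_
  · intro γ
    obtain ⟨⟨t, ht⟩, rfl⟩ := hφ.1 γ
    refine ⟨⟨e * t * e, mul_mem (mul_mem he ht) he, ?_⟩, (hφ.2 _ _).2 ?_⟩
    · change idealPair (e * (e * t * e)) = idealPair e
      rw [← mul_assoc, ← mul_assoc, hee]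
      exact habs t ht
    · change h * (e * t * e) = h * t
      rw [← mul_assoc, ← mul_assoc, hhe]
      obtain ⟨g, hg⟩ := (leftIdeal_eq_iff.1 (idealPair_eq_iff.1 (mem_stab.1 ht)).2).1
      rw [hg, mul_assoc, hhe]
  · intro a b hab
    have hab' : e * (a : M) = e * (b : M) := (hψ.2 _ _).1 hab
    refine (hφ.2 _ _).2 ?_
    change h * (a : M) = h * (b : M)
    rw [← hhe, mul_assoc, hab', mul_assoc]

/-- Schützenberger groups of a residually finite monoid are residually finite. -/
theorem isResiduallyFiniteSemigroup_of_isSchutzenbergerQuotient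
    (hM : IsResiduallyFiniteSemigroup M) (h : M) {Γ : Type*} [Group Γ] {φ : stab h →* Γ}
    (hφ : IsSchutzenbergerQuotient h φ) : IsResiduallyFiniteSemigroup Γ := by
  intro a b hab
  obtain ⟨s, rfl⟩ := hφ.1 a
  obtain ⟨t, rfl⟩ := hφ.1 b
  obtain ⟨U, _, _, f, hf⟩ := hM (h * s) (h * t) fun hst => hab ((hφ.2 _ _).2 hst)
  let X : Set U := f '' {x | idealPair x = idealPair h}
  have : Finite (Function.End X) := inferInstanceAs (Finite (_ → _))
  have : Finite (Function.End X)ᵐᵒᵖ := Finite.of_equiv _ MulOpposite.opEquiv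
  have hX : ∀ (γ : Γ) (u : X), u.1 * f (Function.surjInv hφ.1 γ : stab h) ∈ X := by
    rintro γ ⟨_, x, hx, rfl⟩
    exact ⟨_, idealPair_mul_of_idealPair_eq hx (Function.surjInv hφ.1 γ).2, map_mul _ _ _⟩
  have hsurj : ∀ (s : stab h) (x : M), idealPair x = idealPair h →
      f x * f (Function.surjInv hφ.1 (φ s) : stab h) = f x * f s := by
    intro s x hx
    rw [← map_mul, ← map_mul]
    exact congrArg f (mul_eq_mul_of_idealPair_eq hx ((hφ.2 _ _).1 (Function.surjInv_eq hφ.1 _)))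
  let F : Γ →ₙ* (Function.End X)ᵐᵒᵖ :=
    { toFun γ := MulOpposite.op fun u => ⟨u.1 * f (Function.surjInv hφ.1 γ : stab h), hX γ u⟩
      map_mul' α β := by
        refine congrArg MulOpposite.op (funext fun u => Subtype.ext ?_)
        obtain ⟨_, x, hx, rfl⟩ := u
        obtain ⟨a, rfl⟩ := hφ.1 α
        obtain ⟨b, rfl⟩ := hφ.1 β
        change f x * f (Function.surjInv hφ.1 (φ a * φ b) : stab h) =
          f x * f (Function.surjInv hφ.1 (φ a) : stab h) * f (Function.surjInv hφ.1 (φ b) : stab h)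
        rw [← map_mul φ, hsurj _ _ hx, hsurj _ _ hx, ← map_mul f x (a : M),
          hsurj _ _ (idealPair_mul_of_idealPair_eq hx a.2), ← map_mul, ← map_mul, Submonoid.coe_mul,
          mul_assoc] }
  obtain ⟨V, hV, hV', g, hg⟩ := F.exists_type_zero
  refine ⟨V, hV, hV', g, fun hst => hf ?_⟩
  have := congrArg Subtype.val (congrFun (congrArg MulOpposite.unop (hg _ _ hst))
    ⟨f h, h, rfl, rfl⟩)
  rw [map_mul, map_mul, ← hsurj s h rfl, ← hsurj t h rfl]
  exact this

/-- Let `Q` be a function to a finite type that is `none` exactly outside the `H`-class of `h` and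
that the stabiliser of `h` respects. Then the functions `u ↦ Q (y * u)` form a finite set. -/
theorem finite_range_syntactic (hfin : (Set.range (idealPair (M := M))).Finite) (h : M)
    {V : Type*} [Finite V] (Q : M → Option V)
    (hQ : ∀ z, Q z ≠ none → idealPair z = idealPair h)
    (hQstab : ∀ x y, ∀ s ∈ stab h, idealPair x = idealPair h → idealPair y = idealPair h →
      Q x = Q y → Q (x * s) = Q (y * s)) :
    (Set.range fun y u : M => Q (y * u)).Finite := by
  have hQ' : ∀ z, ¬ idealPair z = idealPair h → Q z = none :=
    fun z hz => by_contra fun hn => hz (hQ z hn)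
  choose c d hcd using fun i => exists_translations i h
  have key : ∀ z z', idealPair z = idealPair z' → rightIdeal z = rightIdeal h →
      Q (z * c (idealPair z)) = Q (z' * c (idealPair z)) → ∀ v, Q (z * v) = Q (z' * v) := by
    intro z z' hzz hz hq v
    obtain ⟨h1, h2⟩ := hcd _ z rfl hz
    obtain ⟨h1', h2'⟩ := hcd _ z' hzz.symm ((idealPair_eq_iff.1 hzz).1.symm.trans hz)
    have e1 : z * v = z * c (idealPair z) * (d (idealPair z) * v) := by rw [← mul_assoc, h2]
    have e2 : z' * v = z' * c (idealPair z) * (d (idealPair z) * v) := by rw [← mul_assoc, h2']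
    rw [e1, e2]
    by_cases hs : d (idealPair z) * v ∈ stab h
    · exact hQstab _ _ _ hs h1 h1' hq
    · rw [hQ' _ (mt (mem_stab_iff_of_idealPair_eq h1).2 hs),
        hQ' _ (mt (mem_stab_iff_of_idealPair_eq h1').2 hs)]
  have hI : Finite (Set.range (rightIdeal (M := M))) := finite_range_rightIdeal hfin
  have hP : Finite (Set.range (idealPair (M := M))) := hfin
  choose w hw using fun i : Set.range (rightIdeal (M := M)) => i.2
  let G : M → Set.range (rightIdeal (M := M)) → Set.range (idealPair (M := M)) × Option V :=
    fun y i => (⟨idealPair (y * w i), y * w i, rfl⟩, Q (y * w i * c (idealPair (y * w i))))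
  refine (Set.toFinite (Set.range G)).range_of_factorsThrough ?_
  intro y y' hyy
  funext u
  have hi := congrFun hyy ⟨rightIdeal u, u, rfl⟩
  have hu := hw ⟨rightIdeal u, u, rfl⟩
  set x := w ⟨rightIdeal u, u, rfl⟩ with hx
  have h1 : idealPair (y * x) = idealPair (y' * x) := congrArg (fun p => p.1.1) hi
  have h2 : Q (y * x * c (idealPair (y * x))) = Q (y' * x * c (idealPair (y' * x))) :=
    congrArg Prod.snd hi
  by_cases hr : rightIdeal (y * x) = rightIdeal h
  · obtain ⟨v, hv⟩ := (rightIdeal_eq_iff.1 hu).2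
    change Q (y * u) = Q (y' * u)
    rw [hv, ← mul_assoc, ← mul_assoc]
    exact key _ _ h1 hr (by rw [h2, ← h1]) v
  · have hr' : ¬ rightIdeal (y' * x) = rightIdeal h := by
      rwa [← (idealPair_eq_iff.1 h1).1]
    rw [rightIdeal_mul_left hu] at hr hr'
    exact (hQ' _ fun e => hr (idealPair_eq_iff.1 e).1).trans
      (hQ' _ fun e => hr' (idealPair_eq_iff.1 e).1).symm

/-- An element with residually finite Schützenberger group can be separated from every other
element in a finite semigroup image. -/
theorem exists_separating_mulHom (hfin : (Set.range (idealPair (M := M))).Finite) {h t : M}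
    (hne : h ≠ t) {Γ : Type*} [Group Γ] {φ : stab h →* Γ} (hφ : IsSchutzenbergerQuotient h φ)
    (hΓ : IsResiduallyFiniteSemigroup Γ) :
    ∃ (U : Type) (_ : Semigroup U) (_ : Finite U) (f : M →ₙ* U), f h ≠ f t := by
  classical
  obtain ⟨V, _, _, ψ, hψ⟩ : ∃ (V : Type) (_ : Semigroup V) (_ : Finite V) (ψ : Γ →ₙ* V),
      ∀ a : stab h, h * (a : M) = t → ψ (φ 1) ≠ ψ (φ a) := by
    by_cases ha : ∃ a : stab h, h * (a : M) = t
    · obtain ⟨a, rfl⟩ := ha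
      obtain ⟨V, _, _, ψ, hψ⟩ := hΓ (φ 1) (φ a) fun e => hne (by
        rw [← (hφ.2 _ _).1 e, Submonoid.coe_one, mul_one])
      refine ⟨V, inferInstance, inferInstance, ψ, fun b hb => ?_⟩
      rwa [(hφ.2 b a).2 hb]
    · exact ⟨PUnit, inferInstance, inferInstance, ⟨fun _ => 1, fun _ _ => rfl⟩,
        fun a hat => (ha ⟨a, hat⟩).elim⟩
  let Q : M → Option V := fun z =>
    if hz : ∃ a : stab h, z = h * (a : M) then some (ψ (φ hz.choose)) else none
  have hQmul : ∀ a : stab h, Q (h * (a : M)) = some (ψ (φ a)) := by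
    intro a
    have hz : ∃ b : stab h, h * (a : M) = h * (b : M) := ⟨a, rfl⟩
    change dite _ _ _ = _
    rw [dif_pos hz, (hφ.2 _ _).2 hz.choose_spec]
  have hex : ∀ z, idealPair z = idealPair h → ∃ a : stab h, z = h * (a : M) := by
    intro z hz
    obtain ⟨a, rfl⟩ := (rightIdeal_eq_iff.1 (idealPair_eq_iff.1 hz).1).1
    exact ⟨⟨a, hz⟩, rfl⟩
  have hnone : ∀ z, Q z ≠ none → idealPair z = idealPair h := by
    intro z hz
    by_contra hn
    refine hz (dif_neg ?_)
    rintro ⟨a, rfl⟩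
    exact hn a.2
  have hrange := finite_range_syntactic hfin h Q hnone (by
    intro x y s hs hx hy hxy
    obtain ⟨a, rfl⟩ := hex x hx
    obtain ⟨b, rfl⟩ := hex y hy
    have h1 := hQmul (a * ⟨s, hs⟩)
    have h2 := hQmul (b * ⟨s, hs⟩)
    rw [hQmul, hQmul, Option.some_inj] at hxy
    rw [map_mul, map_mul, Submonoid.coe_mul, ← mul_assoc] at h1 h2
    rw [h1, h2, hxy])
  obtain ⟨U, hU, hU', f, hf⟩ := exists_mulHom_of_rightInvariant hrange (by
    intro x y u hxy
    funext v
    simpa only [mul_assoc] using congrFun hxy (u * v))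
  refine ⟨U, hU, hU', f, fun e => ?_⟩
  have hht : Q h = Q t := by simpa only [mul_one] using congrFun (hf _ _ e) 1
  have hh : Q h = some (ψ (φ 1)) := by simpa only [Submonoid.coe_one, mul_one] using hQmul 1
  obtain ⟨a, rfl⟩ := hex t (hnone t (by rw [← hht, hh]; exact Option.some_ne_none _))
  rw [hh, hQmul, Option.some_inj] at hht
  exact hψ a rfl hht

/-- In the right Cayley graph with respect to finitely many elements, only finitely many elements
of the `R`-class of `a` can be reached from `a` if its Schützenberger group is locally finite. -/
theorem finite_reachable_inter_rightIdeal (hfin : (Set.range (idealPair (M := M))).Finite)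
    {Y : Set M} (hY : Y.Finite) (a : M) {Γ : Type*} [Group Γ] {φ : stab a →* Γ}
    (hφ : IsSchutzenbergerQuotient a φ) (hΓ : IsLocallyFiniteSemigroup Γ) :
    {x | (∃ t ∈ Submonoid.closure Y, x = a * t) ∧ rightIdeal x = rightIdeal a}.Finite := by
  choose c d hcd using fun i => exists_translations i a
  let D : Set M := insert (c (idealPair a))
    ((fun p : (Set M × Set M) × M × (Set M × Set M) => d p.1 * p.2.1 * c p.2.2) ''
      (Set.range idealPair ×ˢ Y ×ˢ Set.range idealPair))
  have hD : D.Finite := ((hfin.prod (hY.prod hfin)).image _).insert _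
  let E : Set (stab a) := Subtype.val ⁻¹' D
  have hE : E.Finite := hD.preimage Subtype.val_injective.injOn
  let Γ₀ := Subsemigroup.closure (φ '' E)
  have hΓ₀ : (Γ₀ : Set Γ).Finite := by simpa using hΓ (hE.image φ).toFinset
  have hmem : ∀ b : stab a, (b : M) ∈ D → φ b ∈ Γ₀ :=
    fun b hb => Subsemigroup.subset_closure ⟨b, hb, rfl⟩
  have key : ∀ t ∈ Submonoid.closure Y, rightIdeal (a * t) = rightIdeal a →
      ∃ b : stab a, φ b ∈ Γ₀ ∧ a * t * c (idealPair (a * t)) = a * (b : M) := by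
    intro t ht
    induction ht using Submonoid.closure_induction_right with
    | one =>
      intro _
      refine ⟨⟨c (idealPair a), (hcd _ a rfl rfl).1⟩, hmem _ (Set.mem_insert _ _), ?_⟩
      rw [mul_one]
    | mul_right t _ y hy ih =>
      intro hr
      have hrt : rightIdeal (a * t) = rightIdeal a :=
        (rightIdeal_mul_subset a t).antisymm (by
          rw [← hr, ← mul_assoc]
          exact rightIdeal_mul_subset _ _)
      obtain ⟨b, hb, hbt⟩ := ih hrt
      have hcalc : a * (t * y) * c (idealPair (a * (t * y))) =
          a * (b : M) * (d (idealPair (a * t)) * y * c (idealPair (a * (t * y)))) := by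
        simp only [← hbt, ← mul_assoc]
        rw [(hcd _ _ rfl hrt).2]
      have hs : d (idealPair (a * t)) * y * c (idealPair (a * (t * y))) ∈ stab a := by
        rw [mem_stab_iff_of_idealPair_eq b.2, ← hcalc]
        exact (hcd _ _ rfl hr).1
      refine ⟨b * ⟨_, hs⟩, ?_, by rw [hcalc, Submonoid.coe_mul, mul_assoc a]⟩
      rw [map_mul]
      exact mul_mem hb (hmem _ (Set.mem_insert_of_mem _
        ⟨(_, y, _), ⟨⟨_, rfl⟩, hy, ⟨_, rfl⟩⟩, rfl⟩))
  refine ((hΓ₀.prod hfin).image fun p : Γ × (Set M × Set M) =>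
    a * (Function.surjInv hφ.1 p.1 : stab a) * d p.2).subset ?_
  rintro _ ⟨⟨t, ht, rfl⟩, hr⟩
  obtain ⟨b, hb, hbt⟩ := key t ht hr
  refine ⟨(φ b, idealPair (a * t)), ⟨hb, _, rfl⟩, ?_⟩
  change a * ((Function.surjInv hφ.1 (φ b) : stab a) : M) * _ = _
  rw [(hφ.2 _ _).1 (Function.surjInv_eq hφ.1 (φ b)), ← hbt]
  exact (hcd _ _ rfl hr).2

theorem finite_reachable (hfin : (Set.range (idealPair (M := M))).Finite)
    (hlf : ∀ a : M, ∃ (Γ : Type u) (_ : Group Γ) (φ : stab a →* Γ),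
      IsSchutzenbergerQuotient a φ ∧ IsLocallyFiniteSemigroup Γ)
    {Y : Set M} (hY : Y.Finite) (a : M) : {x | ∃ t ∈ Submonoid.closure Y, x = a * t}.Finite := by
  induction a using
    (wellFounded_rightIdeal_ssubset (finite_range_rightIdeal hfin)).induction with
  | _ a ih =>
    obtain ⟨Γ, _, φ, hφ, hΓ⟩ := hlf a
    have hR := finite_reachable_inter_rightIdeal hfin hY a hφ hΓ
    let N : Set M := {q | q ∈ Set.image2 (· * ·)
      {x | (∃ t ∈ Submonoid.closure Y, x = a * t) ∧ rightIdeal x = rightIdeal a} Y ∧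
        rightIdeal q ⊂ rightIdeal a}
    have hN : N.Finite := (hR.image2 _ hY).subset fun q hq => hq.1
    refine (hR.union (hN.biUnion fun q hq => ih q hq.2)).subset ?_
    rintro _ ⟨t, ht, rfl⟩
    induction ht using Submonoid.closure_induction_right with
    | one => exact Or.inl ⟨⟨1, one_mem _, rfl⟩, by rw [mul_one]⟩
    | mul_right t ht y hy iht =>
      rcases iht with iht | iht
      · by_cases hr : rightIdeal (a * (t * y)) = rightIdeal a
        · exact Or.inl ⟨⟨_, mul_mem ht (Submonoid.subset_closure hy), rfl⟩, hr⟩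
        · refine Or.inr (Set.mem_biUnion (x := a * (t * y)) ⟨⟨_, iht, y, hy, mul_assoc _ _ _⟩,
            (rightIdeal_mul_subset _ _).ssubset_of_ne hr⟩ ⟨1, one_mem _, (mul_one _).symm⟩)
      · obtain ⟨q, hq, v, hv, hqv⟩ := Set.mem_iUnion₂.1 iht
        refine Or.inr (Set.mem_biUnion hq ⟨v * y, mul_mem hv (Submonoid.subset_closure hy), ?_⟩)
        rw [← mul_assoc, hqv, mul_assoc]

theorem isLocallyFiniteSemigroup (hfin : (Set.range (idealPair (M := M))).Finite)
    (hlf : ∀ a : M, ∃ (Γ : Type u) (_ : Group Γ) (φ : stab a →* Γ),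
      IsSchutzenbergerQuotient a φ ∧ IsLocallyFiniteSemigroup Γ) :
    IsLocallyFiniteSemigroup M := by
  intro Y
  refine (finite_reachable hfin hlf Y.finite_toSet 1).subset fun x hx => ⟨x, ?_, (one_mul x).symm⟩
  exact Subsemigroup.closure_le (S := (Submonoid.closure (Y : Set M)).toSubsemigroup)
    |>.2 Submonoid.subset_closure hx

section WithOne

variable {S : Type u} [Semigroup S]

theorem eq_one_of_idealPair_eq_one {z : WithOne S} (hz : idealPair z = idealPair 1) : z = 1 := by
  obtain ⟨u, hu⟩ := (rightIdeal_eq_iff.1 (idealPair_eq_iff.1 hz).1).2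
  induction z using WithOne.recOneCoe with
  | one => rfl
  | coe x =>
    induction u using WithOne.recOneCoe with
    | one => exact (WithOne.one_ne_coe (hu.trans (mul_one _))).elim
    | coe y => exact (WithOne.one_ne_coe hu).elim

theorem rightIdeal_coe (x : S) :
    rightIdeal (x : WithOne S) = (↑) '' insert x {z : S | ∃ s : S, z = x * s} := by
  ext z
  constructor
  · rintro ⟨u, rfl⟩
    induction u using WithOne.recOneCoe with
    | one => exact ⟨x, Or.inl rfl, (mul_one _).symm⟩
    | coe y => exact ⟨x * y, Or.inr ⟨y, rfl⟩, rfl⟩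
  · rintro ⟨_, rfl | ⟨y, rfl⟩, rfl⟩
    · exact ⟨1, (mul_one _).symm⟩
    · exact ⟨y, rfl⟩

theorem leftIdeal_coe (x : S) :
    leftIdeal (x : WithOne S) = (↑) '' insert x {z : S | ∃ s : S, z = s * x} := by
  ext z
  constructor
  · rintro ⟨u, rfl⟩
    induction u using WithOne.recOneCoe with
    | one => exact ⟨x, Or.inl rfl, (one_mul _).symm⟩
    | coe y => exact ⟨y * x, Or.inr ⟨y, rfl⟩, rfl⟩
  · rintro ⟨_, rfl | ⟨y, rfl⟩, rfl⟩
    · exact ⟨1, (one_mul _).symm⟩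
    · exact ⟨y, rfl⟩

theorem greenH_iff_idealPair_eq {x y : S} :
    GreenH x y ↔ idealPair (x : WithOne S) = idealPair (y : WithOne S) := by
  rw [idealPair_eq_iff, rightIdeal_coe, rightIdeal_coe, leftIdeal_coe, leftIdeal_coe,
    WithOne.coe_injective.image_injective.eq_iff, WithOne.coe_injective.image_injective.eq_iff,
    GreenH]

theorem coe_image_hClass (x : S) :
    (fun y : S => (y : WithOne S)) '' HClass x =
      {z | idealPair z = idealPair (x : WithOne S)} := by
  ext z
  constructor
  · rintro ⟨y, hy, rfl⟩
    exact (greenH_iff_idealPair_eq.1 hy).symm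
  · intro hz
    induction z using WithOne.recOneCoe with
    | one => exact (WithOne.coe_ne_one (eq_one_of_idealPair_eq_one (Eq.symm hz))).elim
    | coe y => exact ⟨y, greenH_iff_idealPair_eq.2 (Eq.symm hz), rfl⟩

theorem schStab_hClass (x : S) : SchStab (HClass x) = stab (x : WithOne S) := by
  ext s
  change (fun z : WithOne S => z * s) '' ((fun y : S => (y : WithOne S)) '' HClass x) =
    (fun y : S => (y : WithOne S)) '' HClass x ↔ _
  rw [coe_image_hClass]
  constructor
  · intro h
    exact h.subset ⟨x, rfl, rfl⟩
  · intro h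
    refine Set.Subset.antisymm ?_ fun z hz => ?_
    · rintro _ ⟨z, hz, rfl⟩
      exact (mem_stab_iff_of_idealPair_eq hz).1 h
    · obtain ⟨v, hv, -, hvs⟩ := exists_mul_mul_eq h
      refine ⟨z * v, (mem_stab_iff_of_idealPair_eq hz).1 hv, ?_⟩
      have := mul_eq_mul_of_idealPair_eq hz (hvs.trans (mul_one _).symm)
      rwa [mul_one, ← mul_assoc] at this

theorem isSchutzenbergerGroup_iff {x : S} {Γ : Type*} [Group Γ]
    (φ : SchStab (HClass x) →* Γ) :
    IsSchutzenbergerGroup (HClass x) Γ φ ↔ IsSchutzenbergerQuotient (x : WithOne S)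
      (φ.comp (MulEquiv.submonoidCongr (schStab_hClass x).symm).toMonoidHom) := by
  have hrel : ∀ a b : WithOne S,
      (∀ y ∈ HClass x, (y : WithOne S) * a = y * b) ↔ (x : WithOne S) * a = x * b := by
    refine fun a b => ⟨fun h => h x (greenH_iff_idealPair_eq.2 rfl), fun h y hy => ?_⟩
    exact mul_eq_mul_of_idealPair_eq (greenH_iff_idealPair_eq.1 hy).symm h
  let e := MulEquiv.submonoidCongr (schStab_hClass x).symm
  refine and_congr ?_ ?_
  · exact (Function.Surjective.of_comp_iff φ e.surjective).symm
  · simp only [hrel]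
    refine ⟨fun h a b => h (e a) (e b), fun h a b => ?_⟩
    have hab := h (e.symm a) (e.symm b)
    change φ (e (e.symm a)) = φ (e (e.symm b)) ↔ (x : WithOne S) * (a : WithOne S) = x * b at hab
    rwa [e.apply_symm_apply, e.apply_symm_apply] at hab

theorem exists_isSchutzenbergerGroup {x : S} {Γ : Type*} [Group Γ]
    {φ : stab (x : WithOne S) →* Γ} (hφ : IsSchutzenbergerQuotient (x : WithOne S) φ) :
    ∃ ψ : SchStab (HClass x) →* Γ, IsSchutzenbergerGroup (HClass x) Γ ψ :=
  ⟨φ.comp (MulEquiv.submonoidCongr (schStab_hClass x)).toMonoidHom,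
    (isSchutzenbergerGroup_iff _).2 hφ⟩

theorem finite_range_idealPair_withOne (hfin : (Set.range fun x : S => HClass x).Finite) :
    (Set.range (idealPair (M := WithOne S))).Finite := by
  have h : (Set.range fun x : S => idealPair (x : WithOne S)).Finite :=
    hfin.range_of_factorsThrough fun x y hxy => by
      have hy : y ∈ HClass x := by
        change HClass x = HClass y at hxy
        rw [hxy]
        exact greenH_iff_idealPair_eq.2 rfl
      exact greenH_iff_idealPair_eq.1 hy
  refine (h.insert (idealPair 1)).subset ?_
  rintro _ ⟨z, rfl⟩
  induction z using WithOne.recOneCoe with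
  | one => exact Or.inl rfl
  | coe x => exact Or.inr ⟨x, rfl⟩

/-- The Schützenberger group of the `H`-class of an idempotent embeds into the semigroup. -/
theorem exists_injective_mulHom {e : S} (he : e * e = e) {Γ : Type*} [Group Γ]
    {φ : stab (e : WithOne S) →* Γ} (hφ : IsSchutzenbergerQuotient (e : WithOne S) φ) :
    ∃ i : Γ →ₙ* S, Function.Injective i := by
  have hee : (e : WithOne S) * e = e := congrArg WithOne.coe he
  have hex : ∀ γ : Γ, ∃ y : S, ∀ s : stab (e : WithOne S), φ s = γ → (y : WithOne S) = e * s := by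
    intro γ
    obtain ⟨s, rfl⟩ := hφ.1 γ
    obtain ⟨y, -, hy⟩ := (coe_image_hClass e).symm.subset s.2
    exact ⟨y, fun t ht => hy.trans ((hφ.2 _ _).1 ht.symm)⟩
  choose i hi using hex
  refine ⟨⟨i, fun α β => ?_⟩, fun α β h => ?_⟩
  · obtain ⟨a, rfl⟩ := hφ.1 α
    obtain ⟨b, rfl⟩ := hφ.1 β
    apply WithOne.coe_injective
    obtain ⟨g, hg⟩ := (leftIdeal_eq_iff.1 (idealPair_eq_iff.1 (mem_stab.1 a.2)).2).1
    rw [WithOne.coe_mul, hi _ (a * b) (map_mul _ _ _), hi _ a rfl, hi _ b rfl,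
      Submonoid.coe_mul, ← mul_assoc, ← mul_assoc, hg, mul_assoc g (e : WithOne S) e, hee]
  · obtain ⟨a, rfl⟩ := hφ.1 α
    obtain ⟨b, rfl⟩ := hφ.1 β
    refine (hφ.2 _ _).2 ?_
    rw [← hi _ a rfl, ← hi _ b rfl]
    exact congrArg WithOne.coe h

theorem isResiduallyFiniteSemigroup_withOne (hS : IsResiduallyFiniteSemigroup S) :
    IsResiduallyFiniteSemigroup (WithOne S) := by
  have hlift : ∀ {U : Type} [Semigroup U] [Finite U] (f : S →ₙ* U) (a b : WithOne S),
      WithOne.mapMulHom f a ≠ WithOne.mapMulHom f b →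
      ∃ (U : Type) (_ : Semigroup U) (_ : Finite U) (f : WithOne S →ₙ* U), f a ≠ f b := by
    intro U _ _ f a b h
    exact ⟨WithOne U, inferInstance, inferInstanceAs (Finite (Option U)),
      (WithOne.mapMulHom f).toMulHom, h⟩
  let p : S →ₙ* PUnit.{1} := ⟨fun _ => 1, fun _ _ => rfl⟩
  intro a b hab
  induction a using WithOne.recOneCoe with
  | one =>
    induction b using WithOne.recOneCoe with
    | one => exact (hab rfl).elim
    | coe b => exact hlift p _ _ WithOne.one_ne_coe
  | coe a =>
    induction b using WithOne.recOneCoe with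
    | one => exact hlift p _ _ WithOne.coe_ne_one
    | coe b =>
      obtain ⟨U, _, _, f, hf⟩ := hS a b fun h => hab (congrArg WithOne.coe h)
      exact hlift f _ _ fun h => hf (WithOne.coe_injective h)

theorem IsLocallyFiniteSemigroup.of_withOne (hS : IsLocallyFiniteSemigroup (WithOne S)) :
    IsLocallyFiniteSemigroup S := by
  classical
  intro Y
  have h := hS (Y.image (WithOne.coeMulHom (α := S)))
  rw [Finset.coe_image, ← MulHom.map_mclosure, Subsemigroup.coe_map] at h
  exact h.of_finite_image WithOne.coe_injective.injOn

end WithOne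

end GreenRelation

open GreenRelation in
/-- If the maximal subgroups are solvable and torsion, then every Schützenberger group is locally
finite. -/
theorem GreenRelation.isLocallyFiniteSemigroup_of_isMulTorsion {S : Type u} [Semigroup S]
    (hfin : (Set.range fun x : S => HClass x).Finite)
    (hsolv : ∀ x : S, (HClass x ∩ (HClass x * HClass x)).Nonempty →
      ∀ (Γ : Type u) (_ : Group Γ) (φ : SchStab (HClass x) →* Γ),
        IsSchutzenbergerGroup (HClass x) Γ φ → Group.IsSolvable Γ)
    (htor : ∀ e : S, e * e = e → ∀ (Γ : Type u) (_ : Group Γ) (φ : stab (e : WithOne S) →* Γ),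
      IsSchutzenbergerQuotient (e : WithOne S) φ → IsMulTorsion Γ)
    (h : WithOne S) {Γ : Type*} [Group Γ] {φ : stab h →* Γ} (hφ : IsSchutzenbergerQuotient h φ) :
    IsLocallyFiniteSemigroup Γ := by
  refine isLocallyFiniteSemigroup_of_idempotents (finite_range_idealPair_withOne hfin)
    (fun e he => ?_) h hφ
  obtain ⟨G, _, ψ, hψ⟩ := exists_isSchutzenbergerQuotient e
  refine ⟨G, inferInstance, ψ, hψ, ?_⟩
  induction e using WithOne.recOneCoe with
  | one =>
    have : Subsingleton G := ⟨fun a b => by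
      obtain ⟨s, rfl⟩ := hψ.1 a
      obtain ⟨t, rfl⟩ := hψ.1 b
      refine (hψ.2 _ _).2 ?_
      rw [eq_one_of_idealPair_eq_one s.2, eq_one_of_idealPair_eq_one t.2]⟩
    exact fun Y => Set.toFinite _
  | coe e =>
    have hee : e * e = e := WithOne.coe_injective he
    obtain ⟨θ, hθ⟩ := exists_isSchutzenbergerGroup hψ
    have heH : e ∈ HClass e := greenH_iff_idealPair_eq.2 rfl
    have := hsolv e ⟨e, heH, e, heH, e, heH, hee⟩ G _ θ hθ
    exact (htor e hee G _ ψ hψ).isLocallyFiniteSemigroup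

theorem finitely_many_hclasses_weakly_separable (S : Type u) [Semigroup S]
    (hfin : (Set.range fun x : S => HClass x).Finite)
    (hsolv : ∀ x : S, (HClass x ∩ (HClass x * HClass x)).Nonempty →
      ∀ (Γ : Type u) (_ : Group Γ) (φ : SchStab (HClass x) →* Γ),
        IsSchutzenbergerGroup (HClass x) Γ φ → IsSolvable Γ) :
    IsWeaklySubsemigroupSeparable S ↔
      ∀ (x : S) (Γ : Type u) (_ : Group Γ) (φ : SchStab (HClass x) →* Γ),
        IsSchutzenbergerGroup (HClass x) Γ φ → IsWeaklySubsemigroupSeparable Γ := by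
  open GreenRelation in
  constructor
  · intro hS x Γ _ φ hφ
    have hφ' := (isSchutzenbergerGroup_iff φ).1 hφ
    refine (isResiduallyFiniteSemigroup_of_isSchutzenbergerQuotient
      (isResiduallyFiniteSemigroup_withOne hS.isResiduallyFiniteSemigroup) _ hφ')
      |>.isWeaklySubsemigroupSeparable ?_
    refine isLocallyFiniteSemigroup_of_isMulTorsion hfin hsolv (fun e he G _ ψ hψ => ?_) _ hφ'
    obtain ⟨i, hi⟩ := exists_injective_mulHom he hψ
    exact (hS.of_injective i hi).isMulTorsion
  · intro hΓ
    have hsep : ∀ (x : S) (Γ : Type u) (_ : Group Γ) (φ : stab (x : WithOne S) →* Γ),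
        IsSchutzenbergerQuotient (x : WithOne S) φ → IsWeaklySubsemigroupSeparable Γ := by
      intro x Γ _ φ hφ
      obtain ⟨ψ, hψ⟩ := exists_isSchutzenbergerGroup hφ
      exact hΓ x Γ _ ψ hψ
    have hfin' := finite_range_idealPair_withOne hfin
    refine IsResiduallyFiniteSemigroup.isWeaklySubsemigroupSeparable ?_
      (IsLocallyFiniteSemigroup.of_withOne (isLocallyFiniteSemigroup hfin' fun a => ?_))
    · intro s t hst
      obtain ⟨Γ, _, φ, hφ⟩ := exists_isSchutzenbergerQuotient (s : WithOne S)
      obtain ⟨U, _, _, f, hf⟩ := exists_separating_mulHom hfin'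
        (fun h => hst (WithOne.coe_injective h)) hφ
        (hsep s Γ _ φ hφ).isResiduallyFiniteSemigroup
      exact ⟨U, inferInstance, inferInstance, f.comp WithOne.coeMulHom, hf⟩
    · obtain ⟨Γ, _, φ, hφ⟩ := exists_isSchutzenbergerQuotient a
      exact ⟨Γ, inferInstance, φ, hφ, isLocallyFiniteSemigroup_of_isMulTorsion hfin hsolv
        (fun e _ G _ ψ hψ => (hsep e G _ ψ hψ).isMulTorsion) a hφ⟩
end
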